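/- Let 0 < m < n. Then every two-sided orbit of U_{(m)} on 𝔫_{(m)}* contains exactly one comb supercharacter representative; that is, for each λ ∈ 𝔫_{(m)}* there is a unique comb supercharacter representative μ with μ ∈ U_{(m)}λU_{(m)}. -/

import Mathlib

open Matrix BigOperators
open scoped Classical

/-- `n × n` matrices over `F`. -/
abbrev Mat (n : ℕ) (F : Type*) := Matrix (Fin n) (Fin n) F

section Defs

variable {n : ℕ} {F : Type*} [Field F] [Fintype F]

/-- The pattern group `U_P` attached to a relation `P` on `{0,…,n-1}`:
unipotent upper-triangular matrices supported (off the diagonal) on positions `(i,j)` with `P i j`. -/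
def patGroup (P : Fin n → Fin n → Prop) : Set (Mat n F) :=
  {u | (∀ i, u i i = 1) ∧ ∀ i j, i ≠ j → ¬ P i j → u i j = 0}

/-- Truncation of a matrix to the positions allowed by `P` (used to identify a functional on
`𝔫_P` with the matrix of its coefficients on allowable positions). -/
noncomputable def truncP (P : Fin n → Fin n → Prop) (A : Mat n F) : Mat n F :=
  Matrix.of fun i j => if P i j then A i j else 0

/-- The left orbit `U_P λ` of the functional (identified with a matrix) `lam`:
`(aλ)(x) = λ(a⁻¹ x)`, whose coefficient matrix is the truncation of `(a⁻¹)ᵀ * λ`. -/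
noncomputable def dualLeftOrbit (P : Fin n → Fin n → Prop) (lam : Mat n F) : Set (Mat n F) :=
  {mu | ∃ a ∈ (patGroup P : Set (Mat n F)), mu = truncP P ((a⁻¹)ᵀ * lam)}

/-- The two-sided orbit `U_P λ U_P` of the functional `lam`: `(aλb)(x) = λ(a⁻¹ x b⁻¹)`,
whose coefficient matrix is the truncation of `(a⁻¹)ᵀ * λ * (b⁻¹)ᵀ`. -/
noncomputable def dualOrbit (P : Fin n → Fin n → Prop) (lam : Mat n F) : Set (Mat n F) :=
  {mu | ∃ a ∈ (patGroup P : Set (Mat n F)), ∃ b ∈ (patGroup P : Set (Mat n F)),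
    mu = truncP P ((a⁻¹)ᵀ * lam * (b⁻¹)ᵀ)}

/-- The two-sided superclass orbit `{a (v-1) b : a, b ∈ U_P}` attached to `v ∈ U_P`. -/
def classOrbit (P : Fin n → Fin n → Prop) (v : Mat n F) : Set (Mat n F) :=
  {x | ∃ a ∈ (patGroup P : Set (Mat n F)), ∃ b ∈ (patGroup P : Set (Mat n F)),
    x = a * (v - 1) * b}

/-- The pairing `λ(x) = Σ_{i,j} λ_{ij} x_{ij}` of a functional-matrix with a matrix. -/
def pairM (A B : Mat n F) : F := ∑ i, ∑ j, A i j * B i j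

/-- The supercharacter `χ^λ` of the pattern group `U_P` attached to the functional `lam`:
`χ^λ(u) = (|U_Pλ|/|U_PλU_P|) Σ_{μ ∈ U_PλU_P} θ(−μ(u−1))`. -/
noncomputable def superChar (P : Fin n → Fin n → Prop) (θ : AddChar F ℂ)
    (lam u : Mat n F) : ℂ :=
  ((dualLeftOrbit P lam).ncard : ℂ) / ((dualOrbit P lam).ncard : ℂ) *
    ∑ᶠ mu ∈ dualOrbit P lam, θ (- pairM mu (u - 1))

/-- The full order `i < j`, whose pattern group is `U_n`. -/
def Plt (n : ℕ) : Fin n → Fin n → Prop := fun i j => i < j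

/-- The poset `𝒫_(m)` (in 0-based indexing): `i < j`, except that row `0` (row `1` in 1-based
indexing) is only comparable to columns `j` with 1-based value `j+1 > m`.  Its pattern group is
the interpolating group `U_(m)`. -/
def Pm (n m : ℕ) : Fin n → Fin n → Prop := fun i j => i < j ∧ (i.val = 0 → m < j.val + 1)

/-- `𝒮_n(q)`: strictly upper-triangular matrices with at most one nonzero entry in each row
and each column. -/
def Sset (n : ℕ) (F : Type*) [Field F] : Set (Mat n F) :=
  {lam | (∀ i j : Fin n, ¬ i < j → lam i j = 0) ∧
    (∀ (i j j' : Fin n), lam i j ≠ 0 → lam i j' ≠ 0 → j = j') ∧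
    (∀ (i i' j : Fin n), lam i j ≠ 0 → lam i' j ≠ 0 → i = i')}

/-- Adjacency of two nonzero positions of `A` (they share a row or a column): the edges of
the graph `G_A`. -/
def adjRel (A : Mat n F) (p q : Fin n × Fin n) : Prop :=
  p ≠ q ∧ A p.1 p.2 ≠ 0 ∧ A q.1 q.2 ≠ 0 ∧ (p.1 = q.1 ∨ p.2 = q.2)

/-- The connected component of the position `p` in the graph `G_A`. -/
def compOf (A : Mat n F) (p : Fin n × Fin n) : Set (Fin n × Fin n) :=
  {q | Relation.ReflTransGen (adjRel A) p q}

/-- The set of connected components of the graph `G_A`. -/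
def comps (A : Mat n F) : Set (Set (Fin n × Fin n)) :=
  {S | ∃ p : Fin n × Fin n, A p.1 p.2 ≠ 0 ∧ S = compOf A p}

/-- The matrix agreeing with `A` on the positions of `S` and vanishing elsewhere. -/
noncomputable def restrictTo (S : Set (Fin n × Fin n)) (A : Mat n F) : Mat n F :=
  Matrix.of fun i j => if (i, j) ∈ S then A i j else 0

/-- At most one connected component of `G_A` has more than one vertex. -/
def AtMostOneBig (A : Mat n F) : Prop :=
  ∀ p q : Fin n × Fin n, A p.1 p.2 ≠ 0 → A q.1 q.2 ≠ 0 →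
    1 < (compOf A p).ncard → 1 < (compOf A q).ncard → compOf A p = compOf A q

end Defs

section Reps

variable {n : ℕ} {F : Type*} [Field F] [Fintype F]

/-- The vertex-set shape (in 1-based coordinates `(v.1.val + 1, v.2.val + 1)`) of the large
connected component of a comb superclass representative:
`{(1,k_1),…,(1,k_r)} ∪ {(i_1,k_1),…,(i_{r'},k_{r'})}` with
`1 ≤ i_{r'} < ⋯ < i_1 ≤ m < k_1 < ⋯ < k_r ≤ n` and `r' ∈ {r−1, r}`. -/
def CombClassComp (m : ℕ) (S : Set (Fin n × Fin n)) : Prop :=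
  ∃ r r' : ℕ, (r' = r ∨ r' + 1 = r) ∧ 1 ≤ r' ∧
    ∃ i k : ℕ → ℕ,
      (∀ d, 1 ≤ d → d < r' → i (d + 1) < i d) ∧ 1 ≤ i r' ∧ i 1 ≤ m ∧
      m < k 1 ∧ (∀ d, 1 ≤ d → d < r → k d < k (d + 1)) ∧ k r ≤ n ∧
      S = {v : Fin n × Fin n |
        (v.1.val + 1 = 1 ∧ ∃ d, 1 ≤ d ∧ d ≤ r ∧ v.2.val + 1 = k d) ∨
        (∃ d, 1 ≤ d ∧ d ≤ r' ∧ v.1.val + 1 = i d ∧ v.2.val + 1 = k d)}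

/-- `u ∈ U_(m)` is a comb superclass representative (the condition is on `A = u − 1`):
at most one connected component of `G_A` has more than one vertex, and any such component has
the comb shape. -/
def IsCombClassRep (m : ℕ) (A : Mat n F) : Prop :=
  AtMostOneBig A ∧
    ∀ p : Fin n × Fin n, A p.1 p.2 ≠ 0 → 1 < (compOf A p).ncard →
      CombClassComp m (compOf A p)

/-- The vertex-set shape of the large connected component of a path superclass representative:
`{(1,k_1)} ∪ {(i_d,k_d) : 1 ≤ d ≤ r−1} ∪ {(i_d,k_{d+1}) : 1 ≤ d ≤ r−1} ∪ E` with `E = ∅` or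
`E = {(i_r,k_r)}`, where `1 < i_{r'} < ⋯ < i_1 ≤ m < k_1 < ⋯ < k_r ≤ n`, and `r' = r` if
`E ≠ ∅`, `r' = r − 1` if `E = ∅` (`e : Bool` records whether `E ≠ ∅`). -/
def PathClassComp (m : ℕ) (S : Set (Fin n × Fin n)) : Prop :=
  ∃ (r : ℕ) (e : Bool) (i k : ℕ → ℕ),
    1 ≤ r ∧
    (∀ d, 1 ≤ d → d < (if e then r else r - 1) → i (d + 1) < i d) ∧
    1 < i (if e then r else r - 1) ∧ i 1 ≤ m ∧
    m < k 1 ∧ (∀ d, 1 ≤ d → d < r → k d < k (d + 1)) ∧ k r ≤ n ∧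
    S = {v : Fin n × Fin n |
      (v.1.val + 1 = 1 ∧ v.2.val + 1 = k 1) ∨
      (∃ d, 1 ≤ d ∧ d ≤ r - 1 ∧ v.1.val + 1 = i d ∧ v.2.val + 1 = k d) ∨
      (∃ d, 1 ≤ d ∧ d ≤ r - 1 ∧ v.1.val + 1 = i d ∧ v.2.val + 1 = k (d + 1)) ∨
      (e = true ∧ v.1.val + 1 = i r ∧ v.2.val + 1 = k r)}

/-- `u ∈ U_(m)` is a path superclass representative (the condition is on `A = u − 1`). -/
def IsPathClassRep (m : ℕ) (A : Mat n F) : Prop :=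
  AtMostOneBig A ∧
    ∀ p : Fin n × Fin n, A p.1 p.2 ≠ 0 → 1 < (compOf A p).ncard →
      PathClassComp m (compOf A p)

/-- The vertex-set shape of the large connected component of a comb supercharacter
representative: `{(1,k_1)} ∪ {(i_d,k_{d+1}) : 1 ≤ d ≤ r−1} ∪ {(i_d,k_1) : 1 ≤ d ≤ r'}` with
`n ≥ k_1 > k_2 > ⋯ > k_r > m ≥ i_{r'} > ⋯ > i_1 > 1` and `r' ∈ {r−1, r}`. -/
def CombCharComp (m : ℕ) (S : Set (Fin n × Fin n)) : Prop :=
  ∃ r r' : ℕ, (r' = r ∨ r' + 1 = r) ∧ 1 ≤ r' ∧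
    ∃ i k : ℕ → ℕ,
      (∀ d, 1 ≤ d → d < r → k (d + 1) < k d) ∧ m < k r ∧ k 1 ≤ n ∧
      (∀ d, 1 ≤ d → d < r' → i d < i (d + 1)) ∧ i r' ≤ m ∧ 1 < i 1 ∧
      S = {v : Fin n × Fin n |
        (v.1.val + 1 = 1 ∧ v.2.val + 1 = k 1) ∨
        (∃ d, 1 ≤ d ∧ d ≤ r - 1 ∧ v.1.val + 1 = i d ∧ v.2.val + 1 = k (d + 1)) ∨
        (∃ d, 1 ≤ d ∧ d ≤ r' ∧ v.1.val + 1 = i d ∧ v.2.val + 1 = k 1)}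

/-- `λ ∈ 𝔫_(m)^*` is a comb supercharacter representative. -/
def IsCombCharRep (m : ℕ) (A : Mat n F) : Prop :=
  AtMostOneBig A ∧
    ∀ p : Fin n × Fin n, A p.1 p.2 ≠ 0 → 1 < (compOf A p).ncard →
      CombCharComp m (compOf A p)

/-- The vertex-set shape of the large connected component of a path supercharacter
representative: `{(1,k_1)} ∪ {(i_d,k_d) : 1 ≤ d ≤ r−1} ∪ {(i_d,k_{d+1}) : 1 ≤ d ≤ r−1} ∪ E`
with `E = ∅` or `E = {(i_r,k_r)}`, where `n ≥ k_1 > ⋯ > k_r > m ≥ i_{r'} > ⋯ > i_1 > 1`, and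
`r' = r` if `E ≠ ∅`, `r' = r − 1` if `E = ∅`. -/
def PathCharComp (m : ℕ) (S : Set (Fin n × Fin n)) : Prop :=
  ∃ (r : ℕ) (e : Bool) (i k : ℕ → ℕ),
    1 ≤ r ∧
    (∀ d, 1 ≤ d → d < r → k (d + 1) < k d) ∧ m < k r ∧ k 1 ≤ n ∧
    (∀ d, 1 ≤ d → d < (if e then r else r - 1) → i d < i (d + 1)) ∧
    i (if e then r else r - 1) ≤ m ∧ 1 < i 1 ∧
    S = {v : Fin n × Fin n |
      (v.1.val + 1 = 1 ∧ v.2.val + 1 = k 1) ∨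
      (∃ d, 1 ≤ d ∧ d ≤ r - 1 ∧ v.1.val + 1 = i d ∧ v.2.val + 1 = k d) ∨
      (∃ d, 1 ≤ d ∧ d ≤ r - 1 ∧ v.1.val + 1 = i d ∧ v.2.val + 1 = k (d + 1)) ∨
      (e = true ∧ v.1.val + 1 = i r ∧ v.2.val + 1 = k r)}

/-- `λ ∈ 𝔫_(m)^*` is a path supercharacter representative. -/
def IsPathCharRep (m : ℕ) (A : Mat n F) : Prop :=
  AtMostOneBig A ∧
    ∀ p : Fin n × Fin n, A p.1 p.2 ≠ 0 → 1 < (compOf A p).ncard →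
      PathCharComp m (compOf A p)

end Reps


section PatternOrbits

variable {n : ℕ} {F : Type*} [Field F] {P : Fin n → Fin n → Prop}

theorem apply_ne_zero_of_mem_patGroup {u : Mat n F} (hu : u ∈ (patGroup P : Set (Mat n F)))
    {i j : Fin n} (h : u i j ≠ 0) : i = j ∨ P i j := by
  by_contra hc
  push Not at hc
  exact h (hu.2 i j hc.1 hc.2)

theorem one_mem_patGroup : (1 : Mat n F) ∈ (patGroup P : Set (Mat n F)) :=
  ⟨fun i => Matrix.one_apply_eq i, fun _ _ hij _ => Matrix.one_apply_ne hij⟩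

theorem mul_mem_patGroup (hlt : ∀ i j, P i j → i < j)
    (htr : ∀ i j k, P i j → P j k → P i k) {u v : Mat n F}
    (hu : u ∈ (patGroup P : Set (Mat n F))) (hv : v ∈ (patGroup P : Set (Mat n F))) :
    u * v ∈ (patGroup P : Set (Mat n F)) := by
  refine ⟨fun i => ?_, fun i j hij hP => ?_⟩
  · rw [Matrix.mul_apply, Finset.sum_eq_single i]
    · rw [hu.1, hv.1, one_mul]
    · intro b _ hb
      by_contra hne
      rcases apply_ne_zero_of_mem_patGroup hu (left_ne_zero_of_mul hne) with h1 | h1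
      · exact hb h1.symm
      · rcases apply_ne_zero_of_mem_patGroup hv (right_ne_zero_of_mul hne) with h2 | h2
        · exact hb h2
        · exact lt_asymm (hlt _ _ h1) (hlt _ _ h2)
    · intro h; exact absurd (Finset.mem_univ _) h
  · rw [Matrix.mul_apply]
    refine Finset.sum_eq_zero fun b _ => ?_
    by_contra hne
    rcases apply_ne_zero_of_mem_patGroup hu (left_ne_zero_of_mul hne) with h1 | h1 <;>
      rcases apply_ne_zero_of_mem_patGroup hv (right_ne_zero_of_mul hne) with h2 | h2
    · exact hij (h1.trans h2)
    · exact hP (h1 ▸ h2)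
    · exact hP (h2 ▸ h1)
    · exact hP (htr _ _ _ h1 h2)

theorem det_of_mem_patGroup (hlt : ∀ i j, P i j → i < j) {u : Mat n F}
    (hu : u ∈ (patGroup P : Set (Mat n F))) : u.det = 1 := by
  rw [Matrix.det_of_isUpperTriangular]
  · exact Finset.prod_eq_one fun i _ => hu.1 i
  · intro i j hij
    by_contra hne
    rcases apply_ne_zero_of_mem_patGroup hu hne with h | h
    · exact absurd hij (by simp [h])
    · exact lt_asymm (hlt _ _ h) hij

theorem truncP_apply_of_pos {A : Mat n F} {i j : Fin n} (h : P i j) :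
    truncP P A i j = A i j := by simp [truncP, h]

theorem truncP_apply_of_neg {A : Mat n F} {i j : Fin n} (h : ¬ P i j) :
    truncP P A i j = 0 := by simp [truncP, h]

theorem truncP_eq_self {A : Mat n F} (hA : ∀ i j, ¬ P i j → A i j = 0) : truncP P A = A := by
  ext i j
  by_cases h : P i j
  · rw [truncP_apply_of_pos h]
  · rw [truncP_apply_of_neg h, hA i j h]

theorem truncP_mul_left (htr : ∀ i j k, P i j → P j k → P i k) {a A : Mat n F}
    (ha : a ∈ (patGroup P : Set (Mat n F))) :
    truncP P (aᵀ * truncP P A) = truncP P (aᵀ * A) := by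
  ext i j
  by_cases h : P i j
  · rw [truncP_apply_of_pos h, truncP_apply_of_pos h, Matrix.mul_apply, Matrix.mul_apply]
    refine Finset.sum_congr rfl fun l _ => ?_
    by_cases hl : a l i = 0
    · simp [Matrix.transpose_apply, hl]
    · rcases apply_ne_zero_of_mem_patGroup ha hl with h1 | h1
      · rw [h1, truncP_apply_of_pos h]
      · rw [truncP_apply_of_pos (htr _ _ _ h1 h)]
  · rw [truncP_apply_of_neg h, truncP_apply_of_neg h]

theorem truncP_mul_right (htr : ∀ i j k, P i j → P j k → P i k) {b A : Mat n F}
    (hb : b ∈ (patGroup P : Set (Mat n F))) :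
    truncP P (truncP P A * bᵀ) = truncP P (A * bᵀ) := by
  ext i j
  by_cases h : P i j
  · rw [truncP_apply_of_pos h, truncP_apply_of_pos h, Matrix.mul_apply, Matrix.mul_apply]
    refine Finset.sum_congr rfl fun l _ => ?_
    by_cases hl : b j l = 0
    · simp [Matrix.transpose_apply, hl]
    · rcases apply_ne_zero_of_mem_patGroup hb hl with h1 | h1
      · rw [← h1, truncP_apply_of_pos h]
      · rw [truncP_apply_of_pos (htr _ _ _ h h1)]
  · rw [truncP_apply_of_neg h, truncP_apply_of_neg h]

theorem dualOrbit_supported {lam mu : Mat n F} (h : mu ∈ dualOrbit P lam) :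
    ∀ i j, ¬ P i j → mu i j = 0 := by
  obtain ⟨a, -, b, -, rfl⟩ := h
  exact fun i j hij => truncP_apply_of_neg hij

theorem mem_dualOrbit_self {lam : Mat n F} (hlam : ∀ i j, ¬ P i j → lam i j = 0) :
    lam ∈ dualOrbit P lam :=
  ⟨1, one_mem_patGroup, 1, one_mem_patGroup, by simp [truncP_eq_self hlam]⟩

variable [Finite F]

theorem inv_mem_patGroup (hlt : ∀ i j, P i j → i < j)
    (htr : ∀ i j k, P i j → P j k → P i k) {u : Mat n F}
    (hu : u ∈ (patGroup P : Set (Mat n F))) : u⁻¹ ∈ (patGroup P : Set (Mat n F)) := by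
  have hunit : IsUnit u := by
    rw [Matrix.isUnit_iff_isUnit_det, det_of_mem_patGroup hlt hu]; exact isUnit_one
  obtain ⟨g, rfl⟩ := hunit
  obtain ⟨k, hk, hgk⟩ := (isOfFinOrder_iff_pow_eq_one).1 (isOfFinOrder_of_finite g)
  have hpow : ∀ t : ℕ, (g : Mat n F) ^ t ∈ (patGroup P : Set (Mat n F)) := by
    intro t
    induction t with
    | zero => rw [pow_zero]; exact one_mem_patGroup
    | succ t ih => rw [pow_succ]; exact mul_mem_patGroup hlt htr ih hu
  have : ((g : Mat n F))⁻¹ = (g : Mat n F) ^ (k - 1) := by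
    apply Matrix.inv_eq_right_inv
    rw [← pow_succ', Nat.sub_add_cancel hk, ← Units.val_pow_eq_pow_val, hgk, Units.val_one]
  rw [this]
  exact hpow _

theorem mem_dualOrbit_iff (hlt : ∀ i j, P i j → i < j)
    (htr : ∀ i j k, P i j → P j k → P i k) {lam mu : Mat n F} :
    mu ∈ dualOrbit P lam ↔ ∃ a ∈ (patGroup P : Set (Mat n F)),
      ∃ b ∈ (patGroup P : Set (Mat n F)), mu = truncP P (aᵀ * lam * bᵀ) := by
  constructor
  · rintro ⟨a, ha, b, hb, rfl⟩
    exact ⟨_, inv_mem_patGroup hlt htr ha, _, inv_mem_patGroup hlt htr hb, rfl⟩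
  · rintro ⟨a, ha, b, hb, rfl⟩
    refine ⟨_, inv_mem_patGroup hlt htr ha, _, inv_mem_patGroup hlt htr hb, ?_⟩
    rw [Matrix.nonsing_inv_nonsing_inv, Matrix.nonsing_inv_nonsing_inv] <;>
      simp [det_of_mem_patGroup hlt ha, det_of_mem_patGroup hlt hb]

theorem dualOrbit_trans (hlt : ∀ i j, P i j → i < j)
    (htr : ∀ i j k, P i j → P j k → P i k) {lam mu nu : Mat n F}
    (h1 : mu ∈ dualOrbit P lam) (h2 : nu ∈ dualOrbit P mu) : nu ∈ dualOrbit P lam := by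
  rw [mem_dualOrbit_iff hlt htr] at *
  obtain ⟨a, ha, b, hb, rfl⟩ := h1
  obtain ⟨c, hc, d, hd, rfl⟩ := h2
  refine ⟨a * c, mul_mem_patGroup hlt htr ha hc, d * b, mul_mem_patGroup hlt htr hd hb, ?_⟩
  rw [← truncP_mul_right htr hd, truncP_mul_left htr hc, truncP_mul_right htr hd]
  simp only [Matrix.transpose_mul, Matrix.mul_assoc]

theorem truncP_eq_of_mem_dualOrbit (hlt : ∀ i j, P i j → i < j)
    (htr : ∀ i j k, P i j → P j k → P i k) {lam mu : Mat n F} (h : mu ∈ dualOrbit P lam) :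
    ∃ a ∈ (patGroup P : Set (Mat n F)), ∃ b ∈ (patGroup P : Set (Mat n F)),
      truncP P (aᵀ * lam) = truncP P (mu * bᵀ) := by
  rw [mem_dualOrbit_iff hlt htr] at h
  obtain ⟨a, ha, b, hb, rfl⟩ := h
  refine ⟨a, ha, b⁻¹, inv_mem_patGroup hlt htr hb, ?_⟩
  rw [truncP_mul_right htr (inv_mem_patGroup hlt htr hb), Matrix.mul_assoc,
    ← Matrix.transpose_mul, Matrix.nonsing_inv_mul _ (by simp [det_of_mem_patGroup hlt hb]),
    Matrix.transpose_one, Matrix.mul_one]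

theorem dualOrbit_symm (hlt : ∀ i j, P i j → i < j)
    (htr : ∀ i j k, P i j → P j k → P i k) {lam mu : Mat n F}
    (hlam : ∀ i j, ¬ P i j → lam i j = 0) (h : mu ∈ dualOrbit P lam) :
    lam ∈ dualOrbit P mu := by
  obtain ⟨a, ha, b, hb, he⟩ := truncP_eq_of_mem_dualOrbit hlt htr h
  rw [mem_dualOrbit_iff hlt htr]
  have ha' := inv_mem_patGroup hlt htr ha
  refine ⟨a⁻¹, ha', b, hb, ?_⟩
  rw [Matrix.mul_assoc, ← truncP_mul_left htr ha', ← he, truncP_mul_left htr ha',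
    ← Matrix.mul_assoc, ← Matrix.transpose_mul,
    Matrix.mul_nonsing_inv _ (by simp [det_of_mem_patGroup hlt ha]), Matrix.transpose_one,
    Matrix.one_mul, truncP_eq_self hlam]

/-- Adding a combination of columns `l` with `P j l` to column `j` stays in the orbit. -/
theorem exists_column_operation (hlt : ∀ i j, P i j → i < j)
    (htr : ∀ i j k, P i j → P j k → P i k) {A : Mat n F} (hA : ∀ i j, ¬ P i j → A i j = 0)
    (j : Fin n) (w : Fin n → F) (hw : ∀ l, w l ≠ 0 → P j l) :
    ∃ B ∈ dualOrbit P A, (∀ r c, c ≠ j → B r c = A r c) ∧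
      ∀ r, P r j → B r j = A r j + ∑ l, A r l * w l := by
  have hwj : w j = 0 := by
    by_contra h
    exact lt_irrefl _ (hlt _ _ (hw j h))
  have hb : (1 + Matrix.of fun x l => if x = j then w l else 0) ∈
      (patGroup P : Set (Mat n F)) := by
    refine ⟨fun i => ?_, fun x l hxl hP => ?_⟩
    · by_cases h : i = j
      · subst h; simp [hwj]
      · simp [h]
    · by_cases h : x = j
      · subst h
        have : w l = 0 := by by_contra h; exact hP (hw l h)
        simp [Matrix.one_apply_ne hxl, this]
      · simp [Matrix.one_apply_ne hxl, h]
  have hentry : ∀ r c, (A * (1 + Matrix.of fun x l => if x = j then w l else 0 : Mat n F)ᵀ) r c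
      = A r c + if c = j then ∑ l, A r l * w l else 0 := by
    intro r c
    rw [Matrix.transpose_add, Matrix.transpose_one, Matrix.mul_add, Matrix.mul_one,
      Matrix.add_apply, Matrix.mul_apply]
    by_cases h : c = j <;> simp [h]
  refine ⟨truncP P (A * (1 + Matrix.of fun x l => if x = j then w l else 0)ᵀ),
    (mem_dualOrbit_iff hlt htr).2 ⟨1, one_mem_patGroup, _, hb, by simp⟩, ?_, ?_⟩
  · intro r c hc
    by_cases h : P r c
    · rw [truncP_apply_of_pos h, hentry, if_neg hc, add_zero]
    · rw [truncP_apply_of_neg h, hA r c h]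
  · intro r h
    rw [truncP_apply_of_pos h, hentry, if_pos rfl]

/-- Adding a multiple of row `s` to row `i` stays in the orbit if `P s i`. -/
theorem exists_row_operation (hlt : ∀ i j, P i j → i < j)
    (htr : ∀ i j k, P i j → P j k → P i k) {A : Mat n F} (hA : ∀ i j, ¬ P i j → A i j = 0)
    {s i : Fin n} (hsi : P s i) (x : F) :
    ∃ B ∈ dualOrbit P A, (∀ r c, r ≠ i → B r c = A r c) ∧
      ∀ c, P i c → B i c = A i c + x * A s c := by
  have ha : (1 + Matrix.single s i x) ∈ (patGroup P : Set (Mat n F)) := by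
    have hne : s ≠ i := (hlt _ _ hsi).ne
    refine ⟨fun t => ?_, fun t l htl hP => ?_⟩
    · rw [Matrix.add_apply, Matrix.one_apply_eq, Matrix.single_apply_of_ne, add_zero]
      rintro ⟨rfl, h⟩; exact hne h.symm
    · rw [Matrix.add_apply, Matrix.one_apply_ne htl, Matrix.single_apply_of_ne, add_zero]
      rintro ⟨rfl, rfl⟩; exact hP hsi
  have hentry : ∀ r c, ((1 + Matrix.single s i x : Mat n F)ᵀ * A) r c
      = A r c + if r = i then x * A s c else 0 := by
    intro r c
    rw [Matrix.transpose_add, Matrix.transpose_one, Matrix.add_mul, Matrix.one_mul,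
      Matrix.add_apply, Matrix.transpose_single]
    by_cases h : r = i
    · subst h; simp
    · simp [h]
  refine ⟨truncP P ((1 + Matrix.single s i x)ᵀ * A),
    (mem_dualOrbit_iff hlt htr).2 ⟨_, ha, 1, one_mem_patGroup, by simp⟩, ?_, ?_⟩
  · intro r c hr
    by_cases h : P r c
    · rw [truncP_apply_of_pos h, hentry, if_neg hr, add_zero]
    · rw [truncP_apply_of_neg h, hA r c h]
  · intro c h
    rw [truncP_apply_of_pos h, hentry, if_pos rfl]

end PatternOrbits

section CombShapes

variable {n m : ℕ} {F : Type*} [Field F]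

/-- A coordinate-free description of the large component of a comb supercharacter representative:
`o` is the first row and `c` is the column shared with the first row. -/
structure CombShape (m : ℕ) (o c : Fin n) (S : Set (Fin n × Fin n)) : Prop where
  corner_mem : (o, c) ∈ S
  le_corner : m ≤ c.val
  row_zero : ∀ l, (o, l) ∈ S → l = c
  col_unique : ∀ x x' l, (x, l) ∈ S → (x', l) ∈ S → l ≠ c → x = x'
  row_unique : ∀ x l l', (x, l) ∈ S → (x, l') ∈ S → l ≠ c → l' ≠ c → l = l'
  row_lt : ∀ x, (x, c) ∈ S → x.val < m
  le_col : ∀ x l, (x, l) ∈ S → l ≠ c → m ≤ l.val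
  col_lt : ∀ x l, (x, l) ∈ S → l ≠ c → l < c
  corner_of_mem : ∀ x l, (x, l) ∈ S → (x, c) ∈ S
  decreasing : ∀ x x', x ≠ o → x < x' → (x, c) ∈ S → (x', c) ∈ S →
    ∃ l, l ≠ c ∧ (x, l) ∈ S ∧ ∀ l', l' ≠ c → (x', l') ∈ S → l' < l

/-- The conditions on the entries of `A` which say that `A` is a comb supercharacter
representative, `o` being the first row. -/
structure IsLocalComb (m : ℕ) (o : Fin n) (A : Mat n F) : Prop where
  row_zero : ∀ j j', A o j ≠ 0 → A o j' ≠ 0 → j = j'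
  col_unique : ∀ i i' j, A o j = 0 → A i j ≠ 0 → A i' j ≠ 0 → i = i'
  row_unique : ∀ i j j', A o j = 0 → A o j' = 0 → A i j ≠ 0 → A i j' ≠ 0 → j = j'
  row_lt : ∀ i c, A o c ≠ 0 → A i c ≠ 0 → i.val < m
  le_col : ∀ i c l, A o c ≠ 0 → i ≠ o → A i c ≠ 0 → A i l ≠ 0 → l ≠ c → m ≤ l.val
  col_lt : ∀ i c l, A o c ≠ 0 → i ≠ o → A i c ≠ 0 → A i l ≠ 0 → l ≠ c → l < c
  decreasing : ∀ i i' c, A o c ≠ 0 → i ≠ o → i < i' → A i c ≠ 0 → A i' c ≠ 0 →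
    ∃ l, l ≠ c ∧ A i l ≠ 0 ∧ ∀ l', l' ≠ c → A i' l' ≠ 0 → l' < l

theorem strictMonoOn_nat_of_lt_succ {f : ℕ → ℕ} {N : ℕ}
    (hf : ∀ d, 1 ≤ d → d < N → f d < f (d + 1)) {a b : ℕ} (ha : 1 ≤ a) (hab : a < b)
    (hb : b ≤ N) : f a < f b := by
  induction b, hab using Nat.le_induction with
  | base => exact hf a ha hb
  | succ b hab ih => exact (ih (by omega)).trans (hf b (by omega) hb)

theorem strictAntiOn_nat_of_succ_lt {f : ℕ → ℕ} {N : ℕ}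
    (hf : ∀ d, 1 ≤ d → d < N → f (d + 1) < f d) {a b : ℕ} (ha : 1 ≤ a) (hab : a < b)
    (hb : b ≤ N) : f b < f a := by
  induction b, hab using Nat.le_induction with
  | base => exact hf a ha hb
  | succ b hab ih => exact (hf b (by omega) hb).trans (ih (by omega))

theorem eq_of_apply_eq_of_lt_succ {f : ℕ → ℕ} {N : ℕ}
    (hf : ∀ d, 1 ≤ d → d < N → f d < f (d + 1)) {a b : ℕ} (ha : 1 ≤ a) (hb : 1 ≤ b)
    (haN : a ≤ N) (hbN : b ≤ N) (h : f a = f b) : a = b := by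
  rcases lt_trichotomy a b with hab | hab | hab
  · exact absurd h (strictMonoOn_nat_of_lt_succ hf ha hab hbN).ne
  · exact hab
  · exact absurd h (strictMonoOn_nat_of_lt_succ hf hb hab haN).ne'

theorem CombCharComp.exists_combShape {o : Fin n} (ho : o.val = 0)
    {S : Set (Fin n × Fin n)} (h : CombCharComp m S) : ∃ c, CombShape m o c S := by
  obtain ⟨r, r', hr, hr', i, k, hk, hkr, hk1, hi, hir, hi1, rfl⟩ := h
  have kanti : ∀ {a b : ℕ}, 1 ≤ a → a < b → b ≤ r → k b < k a :=
    fun ha hab hb => strictAntiOn_nat_of_succ_lt hk ha hab hb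
  have imono : ∀ {a b : ℕ}, 1 ≤ a → a < b → b ≤ r' → i a < i b :=
    fun ha hab hb => strictMonoOn_nat_of_lt_succ hi ha hab hb
  have iinj : ∀ {a b : ℕ}, 1 ≤ a → 1 ≤ b → a ≤ r' → b ≤ r' → i a = i b → a = b :=
    fun ha hb haN hbN h => eq_of_apply_eq_of_lt_succ hi ha hb haN hbN h
  have kinj : ∀ {a b : ℕ}, 1 ≤ a → 1 ≤ b → a ≤ r → b ≤ r → k a = k b → a = b := by
    intro a b ha hb har hbr h
    rcases lt_trichotomy a b with hab | hab | hab
    · exact absurd h (kanti ha hab hbr).ne'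
    · exact hab
    · exact absurd h (kanti hb hab har).ne
  have ik1 : ∀ {a : ℕ}, 1 ≤ a → a ≤ r' → 1 < i a := by
    intro a ha har
    rcases ha.eq_or_lt with rfl | h
    · exact hi1
    · exact hi1.trans (imono le_rfl h har)
  have ile : ∀ {a : ℕ}, 1 ≤ a → a ≤ r' → i a ≤ m := by
    intro a ha har
    rcases har.eq_or_lt with rfl | h
    · exact hir
    · exact (imono ha h le_rfl).le.trans hir
  have klt : ∀ {a : ℕ}, 1 ≤ a → a ≤ r → m < k a := by
    intro a ha har
    rcases har.eq_or_lt with rfl | h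
    · exact hkr
    · exact hkr.trans (kanti ha h le_rfl)
  have hmk1 : m < k 1 := klt le_rfl (by omega)
  have kle : ∀ {a : ℕ}, 1 ≤ a → a ≤ r → k a ≤ n := by
    intro a ha har
    rcases ha.eq_or_lt with rfl | h
    · exact hk1
    · exact (kanti le_rfl h har).le.trans hk1
  have hc : ∀ l : Fin n, l ≠ ⟨k 1 - 1, by omega⟩ ↔ l.val + 1 ≠ k 1 := by
    intro l; rw [Ne, Fin.ext_iff]; dsimp only; omega
  refine ⟨⟨k 1 - 1, by omega⟩, ?_⟩
  constructor
  · left; constructor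
    · exact congrArg (· + 1) ho
    · dsimp only; omega
  · dsimp only; omega
  · rintro l (⟨-, h⟩ | ⟨d, h1, h2, h3, -⟩ | ⟨d, h1, h2, h3, -⟩)
    · rw [Fin.ext_iff]; dsimp only at h ⊢; omega
    · have := ik1 h1 (by omega); dsimp only at h3; omega
    · have := ik1 h1 (by omega); dsimp only at h3; omega
  · rintro x x' l hx hx' hl
    rw [hc] at hl
    rcases hx with ⟨-, h⟩ | ⟨d, h1, h2, h3, h4⟩ | ⟨d, h1, h2, h3, h4⟩
    · exact absurd h hl
    · rcases hx' with ⟨-, h⟩ | ⟨d', h1', h2', h3', h4'⟩ | ⟨d', h1', h2', h3', h4'⟩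
      · exact absurd h hl
      · have := kinj (by omega) (by omega) (by omega) (by omega) (h4.symm.trans h4')
        have : d = d' := by omega
        subst this
        rw [Fin.ext_iff]; dsimp only at h3 h3'; omega
      · exact absurd h4' hl
    · exact absurd h4 hl
  · rintro x l l' hx hx' hl hl'
    rw [hc] at hl hl'
    rcases hx with ⟨-, h⟩ | ⟨d, h1, h2, h3, h4⟩ | ⟨d, h1, h2, h3, h4⟩
    · exact absurd h hl
    · rcases hx' with ⟨-, h⟩ | ⟨d', h1', h2', h3', h4'⟩ | ⟨d', h1', h2', h3', h4'⟩
      · exact absurd h hl'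
      · have := iinj (by omega) (by omega) (by omega) (by omega) (h3.symm.trans h3')
        subst this
        rw [Fin.ext_iff]; dsimp only at h4 h4'; omega
      · exact absurd h4' hl'
    · exact absurd h4 hl
  · rintro x (⟨h, -⟩ | ⟨d, h1, h2, h3, -⟩ | ⟨d, h1, h2, h3, -⟩)
    · have := ile (a := 1) le_rfl hr'
      dsimp only at h; omega
    · have := ile h1 (by omega); dsimp only at h3; omega
    · have := ile h1 (by omega); dsimp only at h3; omega
  · rintro x l hx hl
    rw [hc] at hl
    rcases hx with ⟨-, h⟩ | ⟨d, h1, h2, h3, h4⟩ | ⟨d, h1, h2, h3, h4⟩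
    · exact absurd h hl
    · have := klt (a := d + 1) (by omega) (by omega)
      dsimp only at h4; omega
    · exact absurd h4 hl
  · rintro x l hx hl
    rw [hc] at hl
    rcases hx with ⟨-, h⟩ | ⟨d, h1, h2, h3, h4⟩ | ⟨d, h1, h2, h3, h4⟩
    · exact absurd h hl
    · have := kanti (a := 1) (b := d + 1) le_rfl (by omega) (by omega)
      rw [Fin.lt_def]
      dsimp only at h4 ⊢; omega
    · exact absurd h4 hl
  · rintro x l (⟨h, -⟩ | ⟨d, h1, h2, h3, -⟩ | ⟨d, h1, h2, h3, -⟩)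
    · left; exact ⟨h, by dsimp only; omega⟩
    · right; right; exact ⟨d, h1, by omega, h3, by dsimp only; omega⟩
    · right; right; exact ⟨d, h1, by omega, h3, by dsimp only; omega⟩
  · intro x x' hxo hxx hx hx'
    have key : ∀ y : Fin n, y ≠ o → (y, (⟨k 1 - 1, by omega⟩ : Fin n)) ∈ {v : Fin n × Fin n |
        (v.1.val + 1 = 1 ∧ v.2.val + 1 = k 1) ∨
        (∃ d, 1 ≤ d ∧ d ≤ r - 1 ∧ v.1.val + 1 = i d ∧ v.2.val + 1 = k (d + 1)) ∨
        (∃ d, 1 ≤ d ∧ d ≤ r' ∧ v.1.val + 1 = i d ∧ v.2.val + 1 = k 1)} →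
        ∃ d, 1 ≤ d ∧ d ≤ r' ∧ y.val + 1 = i d := by
      rintro y hy (⟨h, -⟩ | ⟨d, h1, h2, h3, -⟩ | ⟨d, h1, h2, h3, -⟩)
      · exact absurd (Fin.ext (by dsimp only at h; omega)) hy
      · exact ⟨d, h1, by omega, h3⟩
      · exact ⟨d, h1, h2, h3⟩
    have hxo' : x' ≠ o := by
      rintro rfl
      rw [Fin.lt_def] at hxx; omega
    obtain ⟨d, h1, h2, h3⟩ := key x hxo hx
    obtain ⟨d', h1', h2', h3'⟩ := key x' hxo' hx'
    have hdd : d < d' := by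
      by_contra hcon
      rcases (not_lt.1 hcon).eq_or_lt with rfl | h
      · rw [Fin.lt_def] at hxx; omega
      · have := imono h1' h h2
        rw [Fin.lt_def] at hxx; omega
    have hk2 := kanti (a := 1) (b := d + 1) le_rfl (by omega) (by omega)
    have hmk := klt (a := d + 1) (by omega) (by omega)
    refine ⟨⟨k (d + 1) - 1, by omega⟩, ?_, ?_, ?_⟩
    · rw [hc]; dsimp only; omega
    · right; left; exact ⟨d, h1, by omega, h3, by dsimp only; omega⟩
    · intro l' hl' hl
      rw [hc] at hl'
      rcases hl with ⟨-, h⟩ | ⟨e, g1, g2, g3, g4⟩ | ⟨e, g1, g2, g3, g4⟩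
      · exact absurd h hl'
      · have : e = d' := iinj g1 h1' (by omega) h2' (g3.symm.trans h3')
        subst this
        have := kanti (a := d + 1) (b := e + 1) (by omega) (by omega) (by omega)
        rw [Fin.lt_def]; dsimp only at g4 ⊢; omega
      · exact absurd g4 hl'

theorem CombShape.combCharComp {o c : Fin n} (ho : o.val = 0)
    {S : Set (Fin n × Fin n)} (h : CombShape m o c S) (hne : ∃ x, x ≠ o ∧ (x, c) ∈ S) :
    CombCharComp m S := by
  set T : Finset (Fin n) := Finset.univ.filter fun x => x ≠ o ∧ (x, c) ∈ S with hT
  have memT : ∀ x, x ∈ T ↔ x ≠ o ∧ (x, c) ∈ S := by simp [hT]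
  have hcard : 1 ≤ T.card := by
    obtain ⟨x, hx⟩ := hne
    exact Finset.card_pos.2 ⟨x, (memT x).2 hx⟩
  obtain ⟨row, hrow_mem, hrow_lt, hrow_surj⟩ : ∃ row : ℕ → Fin n,
      (∀ d, 1 ≤ d → d ≤ T.card → row d ∈ T) ∧
      (∀ d d', 1 ≤ d → d < d' → d' ≤ T.card → row d < row d') ∧
      ∀ x ∈ T, ∃ d, 1 ≤ d ∧ d ≤ T.card ∧ row d = x := by
    refine ⟨fun d => if hd : d - 1 < T.card then T.orderEmbOfFin rfl ⟨d - 1, hd⟩ else o,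
      ?_, ?_, ?_⟩
    · intro d h1 h2
      dsimp only
      rw [dif_pos (by omega)]
      exact Finset.orderEmbOfFin_mem _ _ _
    · intro d d' h1 h2 h3
      dsimp only
      rw [dif_pos (by omega), dif_pos (by omega), OrderEmbedding.lt_iff_lt, Fin.lt_def]
      dsimp only
      omega
    · intro x hx
      have : x ∈ Set.range (T.orderEmbOfFin rfl) := by
        rw [Finset.range_orderEmbOfFin]; exact hx
      obtain ⟨⟨d, hd⟩, rfl⟩ := this
      refine ⟨d + 1, by omega, by omega, ?_⟩
      simp [hd]
  obtain ⟨col, hcol⟩ : ∃ col : Fin n → Fin n, ∀ x, (∃ l, l ≠ c ∧ (x, l) ∈ S) →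
      col x ≠ c ∧ (x, col x) ∈ S := by
    refine ⟨fun x => if hx : ∃ l, l ≠ c ∧ (x, l) ∈ S then hx.choose else o, ?_⟩
    intro x hx
    dsimp only
    rw [dif_pos hx]
    exact hx.choose_spec
  obtain ⟨r, hr, hex⟩ : ∃ r, (T.card = r ∨ T.card + 1 = r) ∧
      ∀ d, 1 ≤ d → d ≤ T.card → ((∃ l, l ≠ c ∧ (row d, l) ∈ S) ↔ d ≤ r - 1) := by
    have hlow : ∀ d, 1 ≤ d → d < T.card → ∃ l, l ≠ c ∧ (row d, l) ∈ S := by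
      intro d h1 h2
      have ha := (memT _).1 (hrow_mem d h1 h2.le)
      have hb := (memT _).1 (hrow_mem (d + 1) (by omega) h2)
      obtain ⟨l, hl, hl', -⟩ := h.decreasing _ _ ha.1
        (hrow_lt d (d + 1) h1 (by omega) h2) ha.2 hb.2
      exact ⟨l, hl, hl'⟩
    by_cases hlast : ∃ l, l ≠ c ∧ (row T.card, l) ∈ S
    · refine ⟨T.card + 1, Or.inr rfl, fun d h1 h2 => ⟨fun _ => by omega, fun _ => ?_⟩⟩
      rcases h2.eq_or_lt with rfl | h2
      · exact hlast
      · exact hlow d h1 h2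
    · refine ⟨T.card, Or.inl rfl, fun d h1 h2 => ⟨fun hd => ?_, fun hd => hlow d h1 (by omega)⟩⟩
      rcases h2.eq_or_lt with rfl | h2
      · exact absurd hd hlast
      · omega
  have hcold : ∀ d, 1 ≤ d → d ≤ r - 1 → col (row d) ≠ c ∧ (row d, col (row d)) ∈ S :=
    fun d h1 h2 => hcol _ ((hex d h1 (by omega)).2 h2)
  set k : ℕ → ℕ := fun d => if d = 1 then c.val + 1 else (col (row (d - 1))).val + 1 with hk
  have hk_one : k 1 = c.val + 1 := by simp [hk]
  have hk_succ : ∀ d, 1 ≤ d → k (d + 1) = (col (row d)).val + 1 := by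
    intro d hd
    have : d ≠ 0 := by omega
    simp [hk, this]
  have hrow_ne : ∀ d, 1 ≤ d → d ≤ T.card → row d ≠ o ∧ (row d, c) ∈ S :=
    fun d h1 h2 => (memT _).1 (hrow_mem d h1 h2)
  refine ⟨r, T.card, by omega, hcard, fun d => (row d).val + 1, k, ?_, ?_, ?_, ?_, ?_, ?_, ?_⟩
  · intro d h1 h2
    rw [hk_succ d h1]
    have hd := hcold d h1 (by omega)
    rcases h1.eq_or_lt with rfl | h1
    · rw [hk_one]
      have := Fin.lt_def.1 (h.col_lt _ _ hd.2 hd.1)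
      omega
    · obtain ⟨e, rfl⟩ : ∃ e, d = e + 1 := ⟨d - 1, by omega⟩
      rw [hk_succ e (by omega)]
      have he := hcold e (by omega) (by omega)
      have hre := hrow_ne e (by omega) (by omega)
      have hrd := hrow_ne (e + 1) (by omega) (by omega)
      obtain ⟨l, hl, hlS, hlt⟩ := h.decreasing _ _ hre.1
        (hrow_lt e (e + 1) (by omega) (by omega) (by omega)) hre.2 hrd.2
      have : l = col (row e) := h.row_unique _ _ _ hlS he.2 hl he.1
      subst this
      have := Fin.lt_def.1 (hlt _ hd.1 hd.2)
      omega
  · rcases Nat.lt_or_ge 1 r with h1 | h1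
    · obtain ⟨e, rfl⟩ : ∃ e, r = e + 1 := ⟨r - 1, by omega⟩
      have he := hcold e (by omega) (by omega)
      rw [hk_succ e (by omega)]
      have := h.le_col _ _ he.2 he.1
      omega
    · have : r = 1 := by omega
      rw [this, hk_one]
      have := h.le_corner
      omega
  · rw [hk_one]; exact c.isLt
  · intro d h1 h2
    have := Fin.lt_def.1 (hrow_lt d (d + 1) h1 (by omega) (by omega))
    dsimp only; omega
  · have := h.row_lt _ (hrow_ne T.card hcard le_rfl).2
    dsimp only; omega
  · have := (hrow_ne 1 le_rfl hcard).1
    rw [Ne, Fin.ext_iff] at this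
    dsimp only; omega
  · ext ⟨x, l⟩
    constructor
    · intro hx
      by_cases hxo : x = o
      · subst hxo
        left
        rw [h.row_zero _ hx, hk_one]
        exact ⟨by dsimp only; omega, rfl⟩
      · right
        have hxc := h.corner_of_mem _ _ hx
        obtain ⟨d, h1, h2, rfl⟩ := hrow_surj x ((memT x).2 ⟨hxo, hxc⟩)
        by_cases hl : l = c
        · right; exact ⟨d, h1, h2, rfl, by rw [hl, hk_one]⟩
        · left
          have hd := (hex d h1 h2).1 ⟨l, hl, hx⟩
          refine ⟨d, h1, hd, rfl, ?_⟩
          rw [hk_succ d h1, h.row_unique _ _ _ hx (hcold d h1 hd).2 hl (hcold d h1 hd).1]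
    · rintro (⟨h1, h2⟩ | ⟨d, h1, h2, h3, h4⟩ | ⟨d, h1, h2, h3, h4⟩)
      · have hx : x = o := Fin.ext (by dsimp only at h1; omega)
        have hl : l = c := Fin.ext (by dsimp only at h2; omega)
        rw [hx, hl]; exact h.corner_mem
      · rw [hk_succ d h1] at h4
        have hx : x = row d := Fin.ext (by dsimp only at h3; omega)
        have hl : l = col (row d) := Fin.ext (by dsimp only at h4; omega)
        rw [hx, hl]; exact (hcold d h1 h2).2
      · have hx : x = row d := Fin.ext (by dsimp only at h3; omega)
        have hl : l = c := Fin.ext (by dsimp only at h4; omega)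
        rw [hx, hl]; exact (hrow_ne d h1 h2).2

theorem compOf_symm {A : Mat n F} {p q : Fin n × Fin n} (h : q ∈ compOf A p) :
    p ∈ compOf A q := by
  have : Std.Symm (adjRel A) :=
    ⟨fun _ _ ⟨h1, h2, h3, h4⟩ => ⟨h1.symm, h3, h2, h4.imp Eq.symm Eq.symm⟩⟩
  exact Relation.ReflTransGen.stdSymm.symm _ _ h

theorem compOf_eq_of_mem {A : Mat n F} {p q : Fin n × Fin n} (h : q ∈ compOf A p) :
    compOf A p = compOf A q :=
  Set.ext fun _ => ⟨fun hx => (compOf_symm h).trans hx, fun hx => Relation.ReflTransGen.trans h hx⟩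

theorem apply_ne_zero_of_mem_compOf {A : Mat n F} {p q : Fin n × Fin n} (hp : A p.1 p.2 ≠ 0)
    (h : q ∈ compOf A p) : A q.1 q.2 ≠ 0 := by
  induction h with
  | refl => exact hp
  | tail _ h _ => exact h.2.2.1

theorem mem_compOf_of_adjacent {A : Mat n F} {p q q' : Fin n × Fin n} (hp : A p.1 p.2 ≠ 0)
    (h : q ∈ compOf A p) (hq' : A q'.1 q'.2 ≠ 0) (hs : q.1 = q'.1 ∨ q.2 = q'.2) :
    q' ∈ compOf A p := by
  by_cases hqq : q = q'
  · exact hqq ▸ h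
  · exact Relation.ReflTransGen.tail h ⟨hqq, apply_ne_zero_of_mem_compOf hp h, hq', hs⟩

theorem IsCombCharRep.exists_combShape [Fintype F] {A : Mat n F} (hA : IsCombCharRep m A)
    {o : Fin n} (ho : o.val = 0) {p q : Fin n × Fin n} (hp : A p.1 p.2 ≠ 0)
    (hq : A q.1 q.2 ≠ 0) (hpq : p ≠ q) (hs : p.1 = q.1 ∨ p.2 = q.2) :
    q ∈ compOf A p ∧ ∃ c, CombShape m o c (compOf A p) := by
  have hmem : q ∈ compOf A p :=
    mem_compOf_of_adjacent hp Relation.ReflTransGen.refl hq hs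
  refine ⟨hmem, (hA.2 p hp ?_).exists_combShape ho⟩
  exact (Set.one_lt_ncard_iff (Set.toFinite _)).2
    ⟨p, q, Relation.ReflTransGen.refl, hmem, hpq⟩

theorem IsCombCharRep.isLocalComb [Fintype F] {A : Mat n F} (hm : 0 < m)
    (hA : IsCombCharRep m A) {o : Fin n} (ho : o.val = 0) : IsLocalComb m o A := by
  have hself : ∀ p, p ∈ compOf A p := fun p => Relation.ReflTransGen.refl
  have hshape : ∀ i c, A o c ≠ 0 → i ≠ o → A i c ≠ 0 →
      (i, c) ∈ compOf A (o, c) ∧ CombShape m o c (compOf A (o, c)) := by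
    intro i c h1 h2 h3
    obtain ⟨hmem, c', hc'⟩ := hA.exists_combShape ho (p := (o, c)) (q := (i, c)) h1 h3
      (by simp [h2.symm]) (Or.inr rfl)
    rw [hc'.row_zero c (hself _)]
    rw [hc'.row_zero c (hself _)] at hmem hc'
    exact ⟨hmem, hc'⟩
  constructor
  · intro j j' h1 h2
    by_contra hne
    obtain ⟨hmem, c, hc⟩ := hA.exists_combShape ho (p := (o, j)) (q := (o, j')) h1 h2
      (by simp [hne]) (Or.inl rfl)
    exact hne ((hc.row_zero _ (hself _)).trans (hc.row_zero _ hmem).symm)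
  · intro i i' j h0 h1 h2
    by_contra hne
    obtain ⟨hmem, c, hc⟩ := hA.exists_combShape ho (p := (i, j)) (q := (i', j)) h1 h2
      (by simp [hne]) (Or.inr rfl)
    refine hne (hc.col_unique _ _ _ (hself _) hmem ?_)
    rintro rfl
    exact apply_ne_zero_of_mem_compOf (p := (i, j)) h1 hc.corner_mem h0
  · intro i j j' h0 h0' h1 h2
    by_contra hne
    obtain ⟨hmem, c, hc⟩ := hA.exists_combShape ho (p := (i, j)) (q := (i, j')) h1 h2
      (by simp [hne]) (Or.inl rfl)
    have hcor := apply_ne_zero_of_mem_compOf (p := (i, j)) h1 hc.corner_mem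
    refine hne (hc.row_unique _ _ _ (hself _) hmem ?_ ?_)
    · rintro rfl; exact hcor h0
    · rintro rfl; exact hcor h0'
  · intro i c h0 h1
    by_cases hio : i = o
    · rw [hio, ho]; exact hm
    · obtain ⟨hmem, hc⟩ := hshape i c h0 hio h1
      exact hc.row_lt _ hmem
  · intro i c l h0 hio h1 h2 hl
    obtain ⟨hmem, hc⟩ := hshape i c h0 hio h1
    exact hc.le_col i l (mem_compOf_of_adjacent (p := (o, c)) h0 hmem h2 (Or.inl rfl)) hl
  · intro i c l h0 hio h1 h2 hl
    obtain ⟨hmem, hc⟩ := hshape i c h0 hio h1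
    exact hc.col_lt i l (mem_compOf_of_adjacent (p := (o, c)) h0 hmem h2 (Or.inl rfl)) hl
  · intro i i' c h0 hio hii h1 h2
    obtain ⟨hmem, hc⟩ := hshape i c h0 hio h1
    have hmem' : (i', c) ∈ compOf A (o, c) :=
      mem_compOf_of_adjacent (p := (o, c)) h0 hmem h2 (Or.inr rfl)
    obtain ⟨l, hl, hlS, hlt⟩ := hc.decreasing i i' hio hii hmem hmem'
    exact ⟨l, hl, apply_ne_zero_of_mem_compOf (p := (o, c)) h0 hlS, fun l' hl' h' => hlt l' hl'
      (mem_compOf_of_adjacent (p := (o, c)) h0 hmem' h' (Or.inl rfl))⟩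

theorem IsLocalComb.isCombCharRep [Fintype F] {A : Mat n F} {o : Fin n} (ho : o.val = 0)
    (hsupp : ∀ i j : Fin n, ¬ Pm n m i j → A i j = 0) (hA : IsLocalComb m o A) :
    IsCombCharRep m A := by
  have hcomp : ∀ c, A o c ≠ 0 → ∀ q, q ∈ compOf A (o, c) ↔ A q.1 q.2 ≠ 0 ∧ A q.1 c ≠ 0 := by
    intro c hc q
    constructor
    · intro hq
      induction hq with
      | refl => exact ⟨hc, hc⟩
      | @tail x y _ hxy ih =>
        obtain ⟨hne, hx, hy, hs⟩ := hxy
        refine ⟨hy, ?_⟩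
        rcases hs with hs | hs
        · rw [← hs]; exact ih.2
        · by_cases hxc : x.2 = c
          · rw [← hxc, hs]; exact hy
          · have h0 : A o x.2 = 0 := by
              by_contra h; exact hxc (hA.row_zero _ _ h hc)
            rw [hA.col_unique y.1 x.1 x.2 h0 (by rw [hs]; exact hy) hx]
            exact ih.2
    · rintro ⟨h1, h2⟩
      refine mem_compOf_of_adjacent (q := (q.1, c)) (p := (o, c)) hc ?_ h1 (Or.inl rfl)
      exact mem_compOf_of_adjacent (q := (o, c)) (p := (o, c)) hc
        Relation.ReflTransGen.refl h2 (Or.inr rfl)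
  have hbig : ∀ p : Fin n × Fin n, A p.1 p.2 ≠ 0 → 1 < (compOf A p).ncard →
      ∃ c, A o c ≠ 0 ∧ compOf A p = compOf A (o, c) ∧ ∃ x, x ≠ o ∧ A x c ≠ 0 := by
    intro p hp hcard
    obtain ⟨q, hq, hqp⟩ := Set.exists_ne_of_one_lt_ncard hcard p
    obtain ⟨q, hne, -, hq, hs⟩ : ∃ q, adjRel A p q := by
      rcases Relation.ReflTransGen.cases_head hq with h | ⟨y, hy, -⟩
      · exact absurd h.symm hqp
      · exact ⟨y, hy⟩
    have hcor : ∀ c, A o c ≠ 0 → A p.1 c ≠ 0 → compOf A p = compOf A (o, c) := fun c h1 h2 =>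
      (compOf_eq_of_mem ((hcomp c h1 p).2 ⟨hp, h2⟩)).symm
    rcases hs with hs | hs
    · have hcol : p.2 ≠ q.2 := fun h => hne (Prod.ext hs h)
      have hpo : p.1 ≠ o := by
        intro h
        exact hcol (hA.row_zero _ _ (by rw [← h]; exact hp) (by rw [← h, hs]; exact hq))
      by_cases h0 : A o p.2 = 0
      · have h0' : A o q.2 ≠ 0 := by
          intro h
          exact hcol (hA.row_unique p.1 _ _ h0 h hp (by rw [hs]; exact hq))
        have hpq : A p.1 q.2 ≠ 0 := by rw [hs]; exact hq
        exact ⟨q.2, h0', hcor _ h0' hpq, p.1, hpo, hpq⟩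
      · exact ⟨p.2, h0, hcor _ h0 hp, p.1, hpo, hp⟩
    · have hrow : p.1 ≠ q.1 := fun h => hne (Prod.ext h hs)
      have hpq : A q.1 p.2 ≠ 0 := by rw [hs]; exact hq
      have h0 : A o p.2 ≠ 0 := fun h => hrow (hA.col_unique _ _ _ h hp hpq)
      refine ⟨p.2, h0, hcor _ h0 hp, ?_⟩
      by_cases hpo : p.1 = o
      · exact ⟨q.1, fun h => hrow (hpo.trans h.symm), hpq⟩
      · exact ⟨p.1, hpo, hp⟩
  constructor
  · intro p q hp hq hpc hqc
    obtain ⟨c, hc, hpc, -⟩ := hbig p hp hpc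
    obtain ⟨c', hc', hqc, -⟩ := hbig q hq hqc
    rw [hpc, hqc, hA.row_zero _ _ hc hc']
  · intro p hp hcard
    obtain ⟨c, hc, hpc, x, hxo, hx⟩ := hbig p hp hcard
    rw [hpc]
    have hmem := hcomp c hc
    have hzero : ∀ l, l ≠ c → A o l = 0 := by
      intro l hl; by_contra h; exact hl (hA.row_zero _ _ h hc)
    have hne_o : ∀ y l, (y, l) ∈ compOf A (o, c) → l ≠ c → y ≠ o := by
      rintro y l hy hl rfl
      exact ((hmem _).1 hy).1 (hzero l hl)
    refine CombShape.combCharComp (o := o) (c := c) ho ?_ ⟨x, hxo, (hmem _).2 ⟨hx, hx⟩⟩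
    constructor
    · exact Relation.ReflTransGen.refl
    · by_contra h
      exact hc (hsupp _ _ fun hP => h (by have := hP.2 ho; omega))
    · intro l hl
      exact hA.row_zero _ _ ((hmem _).1 hl).1 hc
    · intro y y' l hy hy' hl
      exact hA.col_unique _ _ _ (hzero l hl) ((hmem _).1 hy).1 ((hmem _).1 hy').1
    · intro y l l' hy hy' hl hl'
      exact hA.row_unique _ _ _ (hzero l hl) (hzero l' hl') ((hmem _).1 hy).1 ((hmem _).1 hy').1
    · intro y hy
      exact hA.row_lt _ _ hc ((hmem _).1 hy).1
    · intro y l hy hl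
      exact hA.le_col y c l hc (hne_o y l hy hl) ((hmem _).1 hy).2 ((hmem _).1 hy).1 hl
    · intro y l hy hl
      exact hA.col_lt y c l hc (hne_o y l hy hl) ((hmem _).1 hy).2 ((hmem _).1 hy).1 hl
    · intro y l hy
      exact (hmem _).2 ⟨((hmem _).1 hy).2, ((hmem _).1 hy).2⟩
    · intro y y' hyo hyy hy hy'
      have hy := ((hmem _).1 hy).1
      have hy' := ((hmem _).1 hy').1
      obtain ⟨l, hl, hlA, hlt⟩ := hA.decreasing y y' c hc hyo hyy hy hy'
      exact ⟨l, hl, (hmem _).2 ⟨hlA, hy⟩, fun l' hl' h' => hlt l' hl' ((hmem _).1 h').1⟩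

end CombShapes

section CombOrbits

variable {n m : ℕ} {F : Type*} [Field F]

theorem Pm.lt (i j : Fin n) (h : Pm n m i j) : i < j := h.1

theorem Pm.trans (i j k : Fin n) (h : Pm n m i j) (h' : Pm n m j k) : Pm n m i k :=
  ⟨h.1.trans h'.1, fun hi => by
    have h1 := h.2 hi
    have h2 := Fin.lt_def.1 h'.1
    omega⟩

theorem pm_of_lt {i j : Fin n} (hi : i.val ≠ 0) (hij : i < j) : Pm n m i j :=
  ⟨hij, fun h => absurd h hi⟩

/-- If two comb representatives in one orbit agree before `(i, j)`, reading the rows from top to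
bottom and each row from right to left, and the second one is nonzero at `(i, j)`, then they
agree at `(i, j)`. -/
theorem IsLocalComb.apply_eq_of_agree {o : Fin n} (ho : o.val = 0) {lam mu a b : Mat n F}
    (hlam : IsLocalComb m o lam) (hmu : IsLocalComb m o mu)
    (hsupp : ∀ i j : Fin n, ¬ Pm n m i j → mu i j = 0)
    (ha : a ∈ (patGroup (Pm n m) : Set (Mat n F))) (hb : b ∈ (patGroup (Pm n m) : Set (Mat n F)))
    (hab : truncP (Pm n m) (aᵀ * lam) = truncP (Pm n m) (mu * bᵀ)) {i j : Fin n}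
    (hrows : ∀ i' < i, ∀ j', lam i' j' = mu i' j') (hcols : ∀ j' > j, lam i j' = mu i j')
    (hij : mu i j ≠ 0) : lam i j = mu i j := by
  have hP : ∀ {i j}, mu i j ≠ 0 → Pm n m i j := fun {i j} h => by
    by_contra hc; exact h (hsupp i j hc)
  have heq : ∀ x y, Pm n m x y → ∑ k, a k x * lam k y = ∑ l, mu x l * b y l := by
    intro x y hxy
    have := congrFun (congrFun hab x) y
    rwa [truncP_apply_of_pos hxy, truncP_apply_of_pos hxy, Matrix.mul_apply,
      Matrix.mul_apply] at this
  have hbcol : ∀ y l, i ≠ o → mu o l ≠ 0 → m ≤ y.val → y < l → b y l = 0 := by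
    intro y l hio hl hy hyl
    have hoi : o < i := by
      rw [Fin.lt_def]; rw [Ne, Fin.ext_iff] at hio; omega
    by_contra hne
    have hoy : Pm n m o y := by
      refine ⟨Fin.lt_def.2 ?_, fun _ => by omega⟩
      have := Fin.lt_def.1 (hP hl).1
      have := (hP hl).2 ho
      by_contra hc
      have h0 : y = o := Fin.ext (by omega)
      rcases apply_ne_zero_of_mem_patGroup hb hne with h | h
      · exact hyl.ne h
      · have := h.2 (by rw [h0, ho])
        have hm : m = 0 := by rw [h0, ho] at hy; omega
        have hi := Fin.lt_def.1 hoi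
        have := hmu.row_lt o l hl hl
        omega
    have h1 := heq o y hoy
    rw [Finset.sum_eq_single o, Finset.sum_eq_single l, ha.1, one_mul, hrows o hoi] at h1
    · have : mu o y = 0 := by
        by_contra h; exact hyl.ne (hmu.row_zero _ _ h hl)
      rw [this] at h1
      exact (mul_ne_zero hl hne) h1.symm
    · intro l' _ hl'
      have : mu o l' = 0 := by
        by_contra h; exact hl' (hmu.row_zero _ _ h hl)
      rw [this, zero_mul]
    · intro h; exact absurd (Finset.mem_univ _) h
    · intro k _ hk
      have : a k o = 0 := by
        by_contra h
        rcases apply_ne_zero_of_mem_patGroup ha h with h | h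
        · exact hk h
        · have := Fin.lt_def.1 h.1; omega
      rw [this, zero_mul]
    · intro h; exact absurd (Finset.mem_univ _) h
  have hio_of : ∀ k, k < i → i ≠ o := by
    rintro k hk rfl
    have := Fin.lt_def.1 hk; omega
  have key := heq i j (hP hij)
  rw [Finset.sum_eq_single i, Finset.sum_eq_single j, ha.1, hb.1, one_mul, mul_one] at key
  · exact key
  · intro l _ hl
    by_contra hne
    have hil := left_ne_zero_of_mul hne
    have hbl := right_ne_zero_of_mul hne
    have hjl : j < l := by
      rcases apply_ne_zero_of_mem_patGroup hb hbl with h | h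
      · exact absurd h.symm hl
      · exact h.1
    by_cases hio : i = o
    · subst hio
      exact hl (hmu.row_zero _ _ hil hij)
    by_cases hol : mu o l = 0
    · by_cases hoj : mu o j = 0
      · exact hl (hmu.row_unique _ _ _ hol hoj hil hij)
      · exact lt_asymm hjl (hmu.col_lt i j l hoj hio hij hil hl)
    · have hmj := hmu.le_col i l j hol hio hil hij hl.symm
      exact hbl (hbcol j l hio hol hmj hjl)
  · intro h; exact absurd (Finset.mem_univ _) h
  · intro k _ hk
    by_contra hne
    have haki := left_ne_zero_of_mul hne
    have hPki : Pm n m k i := by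
      rcases apply_ne_zero_of_mem_patGroup ha haki with h | h
      · exact absurd h hk
      · exact h
    have hki := hPki.1
    have hlamkj := right_ne_zero_of_mul hne
    have hmukj : mu k j ≠ 0 := by rw [← hrows k hki]; exact hlamkj
    have hio := hio_of k hki
    by_cases hoj : mu o j = 0
    · exact hk (hmu.col_unique _ _ _ hoj hmukj hij)
    have him := hmu.row_lt i j hoj hij
    by_cases hko : k = o
    · have := hPki.2 (by rw [hko, ho]); omega
    obtain ⟨l, hl, hkl, hlt⟩ := hmu.decreasing k i j hoj hko hki hmukj hij
    have hml := hmu.le_col k j l hoj hko hmukj hkl hl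
    have hlj := hmu.col_lt k j l hoj hko hmukj hkl hl
    have hi0 : i.val ≠ 0 := fun h => hio (Fin.ext (h.trans ho.symm))
    have hoi : o < i := by rw [Fin.lt_def]; omega
    have h1 := heq i l (pm_of_lt hi0 (Fin.lt_def.2 (by omega)))
    have hlamkl : lam k l ≠ 0 := by rw [hrows k hki]; exact hkl
    have hlamol : lam o l = 0 := by
      rw [hrows o hoi]
      by_contra h
      exact hl (hmu.row_zero _ _ h hoj)
    rw [Finset.sum_eq_single k, Finset.sum_eq_zero] at h1
    · exact mul_ne_zero haki hlamkl h1
    · intro l' _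
      by_contra hne'
      have hil' := left_ne_zero_of_mul hne'
      have hbl' := right_ne_zero_of_mul hne'
      by_cases hl'j : l' = j
      · subst hl'j
        exact hbl' (hbcol l l' hio hoj hml hlj)
      · have hlt' := hlt l' hl'j hil'
        rcases apply_ne_zero_of_mem_patGroup hb hbl' with h | h
        · exact hlt'.ne h.symm
        · exact lt_asymm hlt' h.1
    · intro k' _ hk'
      have : lam k' l = 0 := by
        by_contra h; exact hk' (hlam.col_unique _ _ _ hlamol h hlamkl)
      rw [this, mul_zero]
    · intro h; exact absurd (Finset.mem_univ _) h
  · intro h; exact absurd (Finset.mem_univ _) h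

theorem IsLocalComb.eq_of_mem_dualOrbit [Finite F] {o : Fin n} (ho : o.val = 0)
    {lam mu : Mat n F} (hlam : IsLocalComb m o lam) (hmu : IsLocalComb m o mu)
    (hlam_supp : ∀ i j : Fin n, ¬ Pm n m i j → lam i j = 0)
    (h : mu ∈ dualOrbit (Pm n m) lam) : lam = mu := by
  have hmu_supp := dualOrbit_supported h
  have h' := dualOrbit_symm Pm.lt Pm.trans hlam_supp h
  obtain ⟨a, ha, b, hb, hab⟩ := truncP_eq_of_mem_dualOrbit Pm.lt Pm.trans h
  obtain ⟨a', ha', b', hb', hab'⟩ := truncP_eq_of_mem_dualOrbit Pm.lt Pm.trans h'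
  ext i j
  revert j
  induction i using (wellFounded_lt (α := Fin n)).induction with
  | _ i hrows =>
    intro j
    induction j using (wellFounded_gt (α := Fin n)).induction with
    | _ j hcols =>
      by_cases h0 : mu i j = 0
      · by_cases h1 : lam i j = 0
        · rw [h0, h1]
        · exact (hmu.apply_eq_of_agree ho hlam hlam_supp ha' hb' hab'
            (fun i' hi' j' => (hrows i' hi' j').symm) (fun j' hj' => (hcols j' hj').symm) h1).symm
      · exact hlam.apply_eq_of_agree ho hmu hmu_supp ha hb hab hrows hcols h0

/-- The position of column `j` in the order in which the entries of a row are cleared: from right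
to left, the column of a nonzero entry of the first row `R` being moved just before the columns
of index less than `m`. -/
noncomputable def colRank (m : ℕ) (R : Fin n → F) (j : Fin n) : ℕ :=
  if R j ≠ 0 then n - m else if m ≤ j.val then n - 1 - j.val else n - j.val

theorem colRank_lt_of_le {R : Fin n → F} {j l : Fin n} (hj : R j ≠ 0) (hl : R l = 0)
    (hml : m ≤ l.val) : colRank m R l < colRank m R j := by
  have := l.isLt
  simp only [colRank, hj, hl, ne_eq, not_true_eq_false, not_false_eq_true, if_true, if_false, hml]
  omega

theorem colRank_le (R : Fin n → F) (j : Fin n) : colRank m R j ≤ n := by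
  unfold colRank
  split_ifs <;> omega

theorem colRank_lt_of_lt {R : Fin n → F} (hR : ∀ j, R j ≠ 0 → m ≤ j.val) {j l : Fin n}
    (hjl : j < l) (h : R l = 0 ∨ j.val < m) : colRank m R l < colRank m R j := by
  have hl := l.isLt
  rw [Fin.lt_def] at hjl
  by_cases hRl : R l = 0
  · by_cases hRj : R j = 0
    · simp only [colRank, hRl, hRj, ne_eq, not_true_eq_false, if_false]
      split_ifs <;> omega
    · exact colRank_lt_of_le hRj hRl (by have := hR j hRj; omega)
  · have hjm := h.resolve_left hRl
    have hRj : R j = 0 := by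
      by_contra hc; have := hR j hc; omega
    have := hR l hRl
    simp only [colRank, hRl, hRj, ne_eq, not_true_eq_false, if_false, not_false_eq_true, if_true]
    split_ifs <;> omega

theorem le_of_colRank_lt {R : Fin n → F} {j l : Fin n} (hj : R j ≠ 0) (hl : R l = 0)
    (h : colRank m R l < colRank m R j) : m ≤ l.val := by
  have := l.isLt
  simp only [colRank, hj, hl, ne_eq, not_true_eq_false, not_false_eq_true, if_true,
    if_false] at h
  split_ifs at h <;> omega

theorem colRank_injective {R : Fin n → F} (hR : ∀ j, R j ≠ 0 → m ≤ j.val)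
    (hR1 : ∀ j j', R j ≠ 0 → R j' ≠ 0 → j = j') : Function.Injective (colRank m R) := by
  intro j j' h
  have h1 := j.isLt
  have h2 := j'.isLt
  by_cases hj : R j = 0 <;> by_cases hj' : R j' = 0
  · simp only [colRank, hj, hj', ne_eq, not_true_eq_false, if_false] at h
    rw [Fin.ext_iff]
    split_ifs at h <;> omega
  · have := hR j' hj'
    simp only [colRank, hj, hj', ne_eq, not_true_eq_false, if_false, not_false_eq_true,
      if_true] at h
    split_ifs at h <;> omega
  · have := hR j hj
    simp only [colRank, hj, hj', ne_eq, not_true_eq_false, if_false, not_false_eq_true,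
      if_true] at h
    split_ifs at h <;> omega
  · exact hR1 j j' hj hj'

/-- The conditions which a nonzero entry of a comb representative satisfies with respect to the
entries cleared before it. -/
structure IsCleanAt (m : ℕ) (o : Fin n) (A : Mat n F) (i j : Fin n) : Prop where
  right_eq_zero : ∀ l, j < l → (A o l = 0 ∨ j.val < m) → A i l = 0
  above_eq_zero : A o j = 0 → ∀ s < i, A s j = 0
  row_lt : A o j ≠ 0 → i.val < m
  decreasing : A o j ≠ 0 → ∀ s < i, s ≠ o → A s j ≠ 0 →
    ∃ l, l ≠ j ∧ A s l ≠ 0 ∧ ∀ l', l' ≠ j → m ≤ l'.val → l' < j → A i l' ≠ 0 → l' < l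

/-- `(i', j')` is cleared before `(i, j)`. -/
def Precedes (m : ℕ) (R : Fin n → F) (i' j' i j : Fin n) : Prop :=
  i' < i ∨ i' = i ∧ colRank m R j' < colRank m R j

theorem IsCleanAt.congr {o : Fin n} {A B : Mat n F} {i j : Fin n}
    (hA : IsCleanAt m o A i j) (hoi : o < i) (hR : ∀ j, A o j ≠ 0 → m ≤ j.val)
    (hR1 : ∀ j j', A o j ≠ 0 → A o j' ≠ 0 → j = j')
    (hAB : ∀ i' j', Precedes m (A o) i' j' i j → B i' j' = A i' j') : IsCleanAt m o B i j := by
  have hup : ∀ s < i, ∀ l, B s l = A s l := fun s hs l => hAB s l (Or.inl hs)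
  constructor
  · intro l hjl h
    rw [hup o hoi] at h
    rw [hAB i l (Or.inr ⟨rfl, colRank_lt_of_lt hR hjl h⟩)]
    exact hA.right_eq_zero l hjl h
  · intro h s hs
    rw [hup o hoi] at h
    rw [hup s hs]
    exact hA.above_eq_zero h s hs
  · intro h
    rw [hup o hoi] at h
    exact hA.row_lt h
  · intro h s hs hso hsj
    rw [hup o hoi] at h
    rw [hup s hs] at hsj
    obtain ⟨l, hl, hsl, hlt⟩ := hA.decreasing h s hs hso hsj
    refine ⟨l, hl, by rw [hup s hs]; exact hsl, fun l' hl' hml' hl'j hil' => ?_⟩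
    have h0 : A o l' = 0 := by
      by_contra hc; exact hl' (hR1 _ _ hc h)
    rw [hAB i l' (Or.inr ⟨rfl, colRank_lt_of_le h h0 hml'⟩)] at hil'
    exact hlt l' hl' hml' hl'j hil'

theorem IsLocalComb.of_isCleanAt (hm : 0 < m) {o : Fin n} (ho : o.val = 0) {A : Mat n F}
    (hR : ∀ j, A o j ≠ 0 → m ≤ j.val) (hR1 : ∀ j j', A o j ≠ 0 → A o j' ≠ 0 → j = j')
    (hA : ∀ i j, o < i → A i j ≠ 0 → IsCleanAt m o A i j) : IsLocalComb m o A := by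
  have hpos : ∀ {i : Fin n}, i ≠ o → o < i := fun {i} hi => by
    rw [Fin.lt_def]; rw [Ne, Fin.ext_iff] at hi; omega
  have hcol : ∀ i c l, A o c ≠ 0 → i ≠ o → A i c ≠ 0 → A i l ≠ 0 → l ≠ c →
      l < c ∧ m ≤ l.val := by
    intro i c l hc hi hic hil hl
    have hol : A o l = 0 := by by_contra h; exact hl (hR1 _ _ h hc)
    rcases lt_or_gt_of_ne hl with h | h
    · refine ⟨h, ?_⟩
      by_contra hcon
      exact hic ((hA i l (hpos hi) hil).right_eq_zero c h (Or.inr (by omega)))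
    · exact absurd ((hA i c (hpos hi) hic).right_eq_zero l h (Or.inl hol)) hil
  have hcu : ∀ i i' j, i < i' → A o j = 0 → A i j ≠ 0 → A i' j ≠ 0 → False := by
    intro i i' j hii h0 h1 h2
    have : o < i' := by
      rw [Fin.lt_def] at hii ⊢; omega
    exact h1 ((hA i' j this h2).above_eq_zero h0 i hii)
  have hru : ∀ i j j', j < j' → A o j = 0 → A o j' = 0 → A i j ≠ 0 → A i j' ≠ 0 → False := by
    intro i j j' hjj h0 h0' h1 h2
    have : i ≠ o := by rintro rfl; exact h1 h0
    exact h2 ((hA i j (hpos this) h1).right_eq_zero j' hjj (Or.inl h0'))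
  constructor
  · exact hR1
  · intro i i' j h0 h1 h2
    rcases lt_trichotomy i i' with h | h | h
    · exact (hcu i i' j h h0 h1 h2).elim
    · exact h
    · exact (hcu i' i j h h0 h2 h1).elim
  · intro i j j' h0 h0' h1 h2
    rcases lt_trichotomy j j' with h | h | h
    · exact (hru i j j' h h0 h0' h1 h2).elim
    · exact h
    · exact (hru i j' j h h0' h0 h2 h1).elim
  · intro i c hc hic
    by_cases hi : i = o
    · rw [hi, ho]; exact hm
    · exact (hA i c (hpos hi) hic).row_lt hc
  · exact fun i c l hc hi hic hil hl => (hcol i c l hc hi hic hil hl).2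
  · exact fun i c l hc hi hic hil hl => (hcol i c l hc hi hic hil hl).1
  · intro i i' c hc hi hii hic hic'
    have hi' : i' ≠ o := by
      rintro rfl
      rw [Fin.lt_def] at hii; omega
    obtain ⟨l, hl, hil, hlt⟩ := (hA i' c (hpos hi') hic').decreasing hc i hii hi hic
    exact ⟨l, hl, hil, fun l' hl' h' =>
      have := hcol i' c l' hc hi' hic' h' hl'
      hlt l' hl' this.2 this.1 h'⟩

theorem exists_clear_entry_of_row [Finite F] {R : Fin n → F} {A : Mat n F}
    (hA : ∀ i j : Fin n, ¬ Pm n m i j → A i j = 0) {s i j : Fin n} (hsi : Pm n m s i)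
    (hij : A i j ≠ 0) (hsj : A s j ≠ 0)
    (hs : ∀ l, colRank m R l < colRank m R j → A s l = 0) :
    ∃ B ∈ dualOrbit (Pm n m) A, (∀ i' j', Precedes m R i' j' i j → B i' j' = A i' j') ∧
      B i j = 0 := by
  have hP : Pm n m i j := by by_contra h; exact hij (hA i j h)
  obtain ⟨B, hB, hB1, hB2⟩ :=
    exists_row_operation Pm.lt Pm.trans hA hsi (-(A i j / A s j))
  refine ⟨B, hB, ?_, ?_⟩
  · rintro i' j' (h | ⟨rfl, h⟩)
    · exact hB1 i' j' h.ne
    · by_cases hP' : Pm n m i' j'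
      · rw [hB2 j' hP', hs j' h, mul_zero, add_zero]
      · rw [dualOrbit_supported hB _ _ hP', hA _ _ hP']
  · rw [hB2 j hP]
    field_simp
    ring

theorem exists_clear_entry_of_column [Finite F] {R : Fin n → F} {A : Mat n F}
    (hA : ∀ i j : Fin n, ¬ Pm n m i j → A i j = 0) {i j : Fin n} (hij : A i j ≠ 0)
    (w : Fin n → F) (hw : ∀ l, w l ≠ 0 → Pm n m j l)
    (hup : ∀ s < i, Pm n m s j → ∑ l, A s l * w l = 0) (hi : ∑ l, A i l * w l = -A i j) :
    ∃ B ∈ dualOrbit (Pm n m) A, (∀ i' j', Precedes m R i' j' i j → B i' j' = A i' j') ∧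
      B i j = 0 := by
  have hP : Pm n m i j := by by_contra h; exact hij (hA i j h)
  obtain ⟨B, hB, hB1, hB2⟩ := exists_column_operation Pm.lt Pm.trans hA j w hw
  refine ⟨B, hB, ?_, ?_⟩
  · rintro i' j' (h | ⟨rfl, h⟩)
    · by_cases hj : j' = j
      · subst hj
        by_cases hP' : Pm n m i' j'
        · rw [hB2 i' hP', hup i' h hP', add_zero]
        · rw [dualOrbit_supported hB _ _ hP', hA _ _ hP']
      · exact hB1 i' j' hj
    · exact hB1 i' j' (by rintro rfl; exact lt_irrefl _ h)
  · rw [hB2 i hP, hi, add_neg_cancel]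

/-- A nonzero entry which is not clean can be cleared without changing the entries before it. -/
theorem isCleanAt_or_exists_clear [Finite F] (hm : 0 < m) {o : Fin n} (ho : o.val = 0)
    {A : Mat n F} (hA : ∀ i j : Fin n, ¬ Pm n m i j → A i j = 0)
    (hR1 : ∀ j j', A o j ≠ 0 → A o j' ≠ 0 → j = j') {i j : Fin n} (hoi : o < i)
    (hij : A i j ≠ 0)
    (hclean : ∀ i' j', o < i' → Precedes m (A o) i' j' i j → A i' j' ≠ 0 →
      IsCleanAt m o A i' j') :
    IsCleanAt m o A i j ∨
      ∃ B ∈ dualOrbit (Pm n m) A,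
        (∀ i' j', Precedes m (A o) i' j' i j → B i' j' = A i' j') ∧ B i j = 0 := by
  have hP : ∀ {i j}, A i j ≠ 0 → Pm n m i j := fun {i j} h => by
    by_contra hc; exact h (hA i j hc)
  have hR : ∀ j, A o j ≠ 0 → m ≤ j.val := fun j h => by
    have := (hP h).2 ho; omega
  have hpos : ∀ {s : Fin n}, s ≠ o → o < s := fun {s} hs => by
    rw [Fin.lt_def]; rw [Ne, Fin.ext_iff] at hs; omega
  have hne : ∀ {s : Fin n}, o < s → s.val ≠ 0 := fun {s} hs => by
    rw [Fin.lt_def] at hs; omega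
  have hoj : o < j := hoi.trans (hP hij).1
  by_cases h1 : ∃ l, j < l ∧ (A o l = 0 ∨ j.val < m) ∧ A i l ≠ 0
  · right
    obtain ⟨l, hjl, hl, hil⟩ := h1
    have hcl := hclean i l hoi (Or.inr ⟨rfl, colRank_lt_of_lt hR hjl hl⟩) hil
    by_cases h0 : A o l = 0
    · refine exists_clear_entry_of_column hA hij (Pi.single l (-(A i j / A i l))) ?_ ?_ ?_
      · intro x hx
        have : x = l := by
          by_contra hc; exact hx (Pi.single_eq_of_ne hc _)
        rw [this]
        exact pm_of_lt (hne hoj) hjl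
      · intro s hs _
        simp [Pi.single_apply, hcl.above_eq_zero h0 s hs]
      · simp only [Pi.single_apply, mul_ite, mul_zero, Finset.sum_ite_eq', Finset.mem_univ,
          if_true]
        field_simp
    · have hjm := hl.resolve_left h0
      have hml := hR l h0
      have hex : ∀ s, s ≠ o → s < i → A s l ≠ 0 → ∃ l', l' ≠ l ∧ A s l' ≠ 0 ∧ m ≤ l'.val := by
        intro s hso hs hsl
        obtain ⟨l', hl', hsl', -⟩ := hcl.decreasing h0 s hs hso hsl
        refine ⟨l', hl', hsl', ?_⟩
        by_contra hc
        exact hsl ((hclean s l' (hpos hso) (Or.inl hs) hsl').right_eq_zero l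
          (Fin.lt_def.2 (by omega)) (Or.inr (by omega)))
      choose! f hf using hex
      set T : Finset (Fin n) := Finset.univ.filter fun s => s ≠ o ∧ s < i ∧ A s l ≠ 0 with hT
      have memT : ∀ s, s ∈ T ↔ s ≠ o ∧ s < i ∧ A s l ≠ 0 := by simp [hT]
      have hof : ∀ s ∈ T, A o (f s) = 0 := by
        intro s hs
        obtain ⟨h1, h2, h3⟩ := (memT s).1 hs
        by_contra h
        exact (hf s h1 h2 h3).1 (hR1 _ _ h h0)
      have hdiag : ∀ s ∈ T, ∀ x, x ≤ i → x ≠ s → A x (f s) = 0 := by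
        intro s hs x hx hxs
        obtain ⟨h1, h2, h3⟩ := (memT s).1 hs
        obtain ⟨g1, g2, g3⟩ := hf s h1 h2 h3
        by_contra h
        rcases lt_or_gt_of_ne hxs with hlt | hgt
        · exact h ((hclean s (f s) (hpos h1) (Or.inl h2) g2).above_eq_zero (hof s hs) x hlt)
        · have hpre : Precedes m (A o) x (f s) i j := by
            rcases hx.eq_or_lt with rfl | hx
            · exact Or.inr ⟨rfl, colRank_lt_of_lt hR (Fin.lt_def.2 (by omega))
                (Or.inl (hof s hs))⟩
            · exact Or.inl hx
          exact g2 ((hclean x (f s) ((hpos h1).trans hgt) hpre h).above_eq_zero (hof s hs) s hgt)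
      set c : F := -(A i j / A i l) with hc
      have hsum : ∀ x, ∑ y, A x y * (c * ((if y = l then 1 else 0) -
          ∑ s ∈ T, if y = f s then A s l / A s (f s) else 0)) =
          c * (A x l - ∑ s ∈ T, A x (f s) * (A s l / A s (f s))) := by
        intro x
        have : ∀ y, A x y * (c * ((if y = l then 1 else 0) -
          ∑ s ∈ T, if y = f s then A s l / A s (f s) else 0)) =
          c * ((if y = l then A x y else 0) -
          ∑ s ∈ T, if y = f s then A x y * (A s l / A s (f s)) else 0) := by
          intro y
          rw [mul_left_comm, mul_sub, Finset.mul_sum]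
          simp only [mul_ite, mul_one, mul_zero]
        simp only [this]
        rw [← Finset.mul_sum, Finset.sum_sub_distrib, Finset.sum_comm]
        simp
      refine exists_clear_entry_of_column hA hij (fun y => c * ((if y = l then 1 else 0) -
          ∑ s ∈ T, if y = f s then A s l / A s (f s) else 0)) ?_ ?_ ?_
      · intro y hy
        by_cases hyl : y = l
        · rw [hyl]; exact pm_of_lt (hne hoj) hjl
        · have hy' := right_ne_zero_of_mul hy
          rw [if_neg hyl, zero_sub, neg_ne_zero] at hy'
          obtain ⟨s, hs, hys⟩ := Finset.exists_ne_zero_of_sum_ne_zero hy'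
          have : y = f s := by
            by_contra h; exact hys (if_neg h)
          obtain ⟨h1, h2, h3⟩ := (memT s).1 hs
          have := (hf s h1 h2 h3).2.2
          exact pm_of_lt (hne hoj) (Fin.lt_def.2 (by omega))
      · intro s hs hsj
        have hso : s ≠ o := by
          rintro rfl
          have := hsj.2 ho; omega
        rw [hsum]
        by_cases hsT : s ∈ T
        · rw [Finset.sum_eq_single s]
          · obtain ⟨h1, h2, h3⟩ := (memT s).1 hsT
            have := (hf s h1 h2 h3).2.1
            field_simp
            ring
          · intro x hx hxs
            rw [hdiag x hx s hs.le hxs.symm, zero_mul]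
          · intro h; exact absurd hsT h
        · have : A s l = 0 := by
            by_contra h; exact hsT ((memT s).2 ⟨hso, hs, h⟩)
          rw [this, Finset.sum_eq_zero, sub_zero, mul_zero]
          intro x hx
          rw [hdiag x hx s hs.le (by rintro rfl; exact hsT hx), zero_mul]
      · rw [hsum, Finset.sum_eq_zero, sub_zero, hc]
        · field_simp
        · intro x hx
          rw [hdiag x hx i le_rfl ((memT x).1 hx).2.1.ne', zero_mul]
  by_cases h2 : A o j = 0 ∧ ∃ s, s < i ∧ A s j ≠ 0
  · right
    obtain ⟨h0, s, hs, hsj⟩ := h2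
    have hso : s ≠ o := by rintro rfl; exact hsj h0
    have hcl := hclean s j (hpos hso) (Or.inl hs) hsj
    refine exists_clear_entry_of_row hA (pm_of_lt (hne (hpos hso)) hs) hij hsj fun l hl => ?_
    by_contra hsl
    have hlj : l ≠ j := by rintro rfl; exact lt_irrefl _ hl
    rcases lt_or_gt_of_ne hlj with h | h
    · exact lt_asymm hl (colRank_lt_of_lt hR h (Or.inl h0))
    · refine hsl (hcl.right_eq_zero l h ?_)
      by_contra! hc
      exact lt_asymm hl (colRank_lt_of_le hc.1 h0 hc.2)
  by_cases h3 : A o j ≠ 0 ∧ m ≤ i.val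
  · right
    refine exists_clear_entry_of_row hA ⟨hoi, fun _ => by omega⟩ hij h3.1 fun l hl => ?_
    by_contra h
    rw [hR1 _ _ h h3.1] at hl
    exact lt_irrefl _ hl
  by_cases h4 : A o j ≠ 0 ∧ ∃ s, s < i ∧ s ≠ o ∧ A s j ≠ 0 ∧ ∀ l, l ≠ j → A s l ≠ 0 →
      ∃ l', l' ≠ j ∧ m ≤ l'.val ∧ l' < j ∧ A i l' ≠ 0 ∧ l ≤ l'
  · right
    obtain ⟨h0, s, hs, hso, hsj, hbad⟩ := h4
    by_cases hrow : ∀ l, colRank m (A o) l < colRank m (A o) j → A s l = 0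
    · exact exists_clear_entry_of_row hA (pm_of_lt (hne (hpos hso)) hs) hij hsj hrow
    push Not at hrow
    obtain ⟨l, hlr, hsl⟩ := hrow
    have hlj : l ≠ j := by rintro rfl; exact lt_irrefl _ hlr
    have hzero : ∀ x, x ≠ j → A o x = 0 := by
      intro x hx; by_contra h; exact hx (hR1 _ _ h h0)
    have hml := le_of_colRank_lt h0 (hzero l hlj) hlr
    obtain ⟨l', hl'j, hml', hl'lt, hil', hll'⟩ := hbad l hlj hsl
    have hcl := hclean i l' hoi
      (Or.inr ⟨rfl, colRank_lt_of_le h0 (hzero l' hl'j) hml'⟩) hil'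
    have habove := hcl.above_eq_zero (hzero l' hl'j)
    have hlt : l < l' := by
      refine hll'.lt_of_ne ?_
      rintro rfl
      exact hsl (habove s hs)
    obtain ⟨B, hB, hB1, hB2⟩ := exists_row_operation Pm.lt Pm.trans hA
      (pm_of_lt (hne (hpos hso)) hs) (-(A i j / A s j))
    obtain ⟨C, hC, hC1, hC2⟩ := exists_column_operation Pm.lt Pm.trans (dualOrbit_supported hB) l
      (Pi.single l' (A i j / A s j * A s l / A i l')) (by
        intro x hx
        have : x = l' := by
          by_contra hc; exact hx (Pi.single_eq_of_ne hc _)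
        rw [this]
        exact pm_of_lt (by omega) hlt)
    have hCl : ∀ r, Pm n m r l → C r l = B r l + B r l' * (A i j / A s j * A s l / A i l') := by
      intro r hr
      rw [hC2 r hr]
      simp [Pi.single_apply]
    refine ⟨C, dualOrbit_trans Pm.lt Pm.trans hB hC, ?_, ?_⟩
    · rintro x y hxy
      by_cases hPxy : Pm n m x y
      swap
      · rw [dualOrbit_supported hC _ _ hPxy, hA _ _ hPxy]
      rcases hxy with hx | ⟨rfl, hy⟩
      · by_cases hyl : y = l
        · subst hyl
          rw [hCl x hPxy, hB1 x _ hx.ne, hB1 x _ hx.ne, habove x hx, zero_mul, add_zero]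
        · rw [hC1 x y hyl, hB1 x y hx.ne]
      · by_cases hyl : y = l
        · subst hyl
          rw [hCl x hPxy, hB2 y hPxy, hB2 l' (hP hil'), habove s hs]
          field_simp
          ring
        · rw [hC1 x y hyl, hB2 y hPxy]
          have hyj : y ≠ j := by rintro rfl; exact lt_irrefl _ hy
          have : A s y = 0 := by
            by_contra hsy
            rcases lt_or_gt_of_ne hyl with h | h
            · exact hsl ((hclean s y (hpos hso) (Or.inl hs) hsy).right_eq_zero l h
                (Or.inl (hzero l hlj)))
            · exact hsy ((hclean s l (hpos hso) (Or.inl hs) hsl).right_eq_zero y h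
                (Or.inl (hzero y hyj)))
          rw [this, mul_zero, add_zero]
    · rw [hC1 i j hlj.symm, hB2 j (hP hij)]
      field_simp
      ring
  · left
    push Not at h1 h2 h3 h4
    refine ⟨h1, h2, h3, fun h0 s hs hso hsj => ?_⟩
    obtain ⟨l, hl, hsl, h⟩ := h4 h0 s hs hso hsj
    exact ⟨l, hl, hsl, h⟩

theorem exists_mem_dualOrbit_row_zero [Finite F] {o : Fin n} (ho : o.val = 0) {lam : Mat n F}
    (hlam : ∀ i j : Fin n, ¬ Pm n m i j → lam i j = 0) :
    ∃ B ∈ dualOrbit (Pm n m) lam, ∀ j j', B o j ≠ 0 → B o j' ≠ 0 → j = j' := by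
  have key : ∀ t : ℕ, ∃ B ∈ dualOrbit (Pm n m) lam,
      ∀ j l, j < l → n ≤ j.val + t → B o j ≠ 0 → B o l = 0 := by
    intro t
    induction t with
    | zero => exact ⟨lam, mem_dualOrbit_self hlam, fun j l _ h => by have := j.isLt; omega⟩
    | succ t ih =>
      obtain ⟨B, hB, hBz⟩ := ih
      by_cases hex : ∃ j l : Fin n, j < l ∧ n = j.val + t + 1 ∧ B o j ≠ 0 ∧ B o l ≠ 0
      · obtain ⟨j, l, hjl, hjt, hj, hl⟩ := hex
        have hPj : Pm n m o j := by by_contra h; exact hj (dualOrbit_supported hB _ _ h)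
        obtain ⟨C, hC, hC1, hC2⟩ := exists_column_operation Pm.lt Pm.trans
          (dualOrbit_supported hB) j (Pi.single l (-(B o j / B o l))) (by
            intro x hx
            have : x = l := by
              by_contra hc; exact hx (Pi.single_eq_of_ne hc _)
            rw [this]
            have := Fin.lt_def.1 hPj.1
            exact pm_of_lt (by omega) hjl)
        have hCj : C o j = 0 := by
          rw [hC2 o hPj]
          simp only [Pi.single_apply, mul_ite, mul_zero, Finset.sum_ite_eq', Finset.mem_univ,
            if_true]
          field_simp
          ring
        refine ⟨C, dualOrbit_trans Pm.lt Pm.trans hB hC, fun x y hxy hx hCx => ?_⟩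
        have hxj : x ≠ j := by rintro rfl; exact hCx hCj
        have hxj' := hxj
        rw [Ne, Fin.ext_iff] at hxj'
        have hxy' := Fin.lt_def.1 hxy
        have hyj : y ≠ j := by
          rintro rfl; omega
        rw [hC1 o x hxj] at hCx
        rw [hC1 o y hyj]
        exact hBz x y hxy (by omega) hCx
      · push Not at hex
        refine ⟨B, hB, fun j l hjl hj hBj => ?_⟩
        by_cases hn : n = j.val + t + 1
        · exact hex j l hjl hn hBj
        · exact hBz j l hjl (by omega) hBj
  obtain ⟨B, hB, hBz⟩ := key n
  refine ⟨B, hB, fun j j' h h' => ?_⟩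
  rcases lt_trichotomy j j' with hlt | rfl | hlt
  · exact absurd (hBz j j' hlt (by omega) h) h'
  · rfl
  · exact absurd (hBz j' j hlt (by omega) h') h

theorem exists_isLocalComb_mem_dualOrbit [Finite F] (hm : 0 < m) {o : Fin n} (ho : o.val = 0)
    {lam : Mat n F} (hlam : ∀ i j : Fin n, ¬ Pm n m i j → lam i j = 0) :
    ∃ B ∈ dualOrbit (Pm n m) lam, IsLocalComb m o B := by
  obtain ⟨A, hA, hR1⟩ := exists_mem_dualOrbit_row_zero ho hlam
  set R := A o with hRdef
  have hR : ∀ j, R j ≠ 0 → m ≤ j.val := fun j h => by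
    have hP : Pm n m o j := by by_contra hc; exact h (dualOrbit_supported hA _ _ hc)
    have := hP.2 ho
    omega
  have key : ∀ t : ℕ, ∀ s : ℕ, ∃ B ∈ dualOrbit (Pm n m) lam, B o = R ∧
      ∀ i j, o < i → (i.val < t ∨ i.val = t ∧ colRank m R j < s) → B i j ≠ 0 →
        IsCleanAt m o B i j := by
    intro t
    induction t with
    | zero =>
      exact fun s => ⟨A, hA, rfl, fun i j hi h => by rw [Fin.lt_def] at hi; omega⟩
    | succ t iht =>
      intro s
      induction s with
      | zero =>
        obtain ⟨B, hB, hBo, hBc⟩ := iht (n + 1)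
        refine ⟨B, hB, hBo, fun i j hi h => hBc i j hi ?_⟩
        have := colRank_le (m := m) R j
        omega
      | succ s ihs =>
        obtain ⟨B, hB, hBo, hBc⟩ := ihs
        by_cases hex : ∃ i j : Fin n, i.val = t + 1 ∧ colRank m R j = s ∧ B i j ≠ 0 ∧
            ¬ IsCleanAt m o B i j
        · obtain ⟨i, j, hi, hj, hij, hcl⟩ := hex
          have hoi : o < i := by rw [Fin.lt_def]; omega
          have hpre : ∀ x y, Precedes m R x y i j ↔
              (x.val < t + 1 ∨ x.val = t + 1 ∧ colRank m R y < s) := by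
            intro x y
            rw [Precedes, hj, Fin.lt_def, Fin.ext_iff, hi]
          obtain ⟨C, hC, hCB, hCij⟩ := (isCleanAt_or_exists_clear hm ho (dualOrbit_supported hB)
            (by rw [hBo]; exact hR1) hoi hij (fun x y hx hxy => by
              rw [hBo, hpre] at hxy
              exact hBc x y hx hxy)).resolve_left hcl
          rw [hBo] at hCB
          refine ⟨C, dualOrbit_trans Pm.lt Pm.trans hB hC, ?_, fun x y hx hxy hCxy => ?_⟩
          · ext y
            rw [hCB o y (Or.inl hoi), hBo]
          · have hxy' : Precedes m R x y i j := by
              rw [hpre]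
              by_contra hcon
              have hxt : x = i := Fin.ext (by omega)
              have hyj : y = j := colRank_injective hR hR1 (by omega)
              rw [hxt, hyj] at hCxy
              exact hCxy hCij
            have hBxy : B x y ≠ 0 := by rw [← hCB x y hxy']; exact hCxy
            refine (hBc x y hx ((hpre x y).1 hxy') hBxy).congr hx (by rw [hBo]; exact hR)
              (by rw [hBo]; exact hR1) fun x' y' h' => hCB x' y' ?_
            rw [hBo] at h'
            rcases h' with h' | ⟨rfl, h'⟩
            · rcases hxy' with h | ⟨rfl, h⟩
              · exact Or.inl (h'.trans h)
              · exact Or.inl h'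
            · rcases hxy' with h | ⟨rfl, h⟩
              · exact Or.inl h
              · exact Or.inr ⟨rfl, h'.trans h⟩
        · push Not at hex
          refine ⟨B, hB, hBo, fun i j hi h hBij => ?_⟩
          by_cases hs : i.val = t + 1 ∧ colRank m R j = s
          · exact hex i j hs.1 hs.2 hBij
          · exact hBc i j hi (by omega) hBij
  obtain ⟨B, hB, hBo, hBc⟩ := key n 0
  exact ⟨B, hB, .of_isCleanAt hm ho (by rw [hBo]; exact hR) (by rw [hBo]; exact hR1)
    fun i j hi hij => hBc i j hi (Or.inl i.isLt) hij⟩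

end CombOrbits

/-- For `0 < m < n`, every two-sided orbit of `U_(m)` on `𝔫_(m)^*` contains
exactly one comb supercharacter representative. -/
theorem stmt8 {n m : ℕ} (hm : 0 < m) (hmn : m < n) {F : Type*} [Field F] [Fintype F]
    (lam : Mat n F) (hlam : ∀ i j : Fin n, ¬ Pm n m i j → lam i j = 0) :
    ∃! mu : Mat n F, (∀ i j : Fin n, ¬ Pm n m i j → mu i j = 0) ∧
      IsCombCharRep m mu ∧ mu ∈ dualOrbit (Pm n m) lam := by
  obtain ⟨o, ho⟩ : ∃ o : Fin n, o.val = 0 := ⟨⟨0, by omega⟩, rfl⟩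
  obtain ⟨B, hB, hBl⟩ := exists_isLocalComb_mem_dualOrbit hm ho hlam
  refine ⟨B, ⟨dualOrbit_supported hB, hBl.isCombCharRep ho (dualOrbit_supported hB), hB⟩, ?_⟩
  rintro mu ⟨hmu, hrep, hmem⟩
  exact (hrep.isLocalComb hm ho).eq_of_mem_dualOrbit ho hBl hmu
    (dualOrbit_trans Pm.lt Pm.trans (dualOrbit_symm Pm.lt Pm.trans hlam hmem) hB)
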